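/- arXiv:1803.03118 — 4 statements merged into one kernel-verified Lean document; each statement's English description precedes it below -/
import Mathlib

section
/- Let n ≥ 2 be an integer, λ = (n-1)/2, a > 0, m ∈ ℕ, and set r = e^{-a} and ê = (1,0,…,0) ∈ ℝ^{n+1}. Define integers α_l^m by: α_0^0 = 1; α_0^m = 0 for m ≥ 1; α_l^m = 0 for l > m; and α_l^{m+1} = l·α_l^m + α_{l-1}^m for l ≥ 1. Then for every y on the unit sphere S^n ⊂ ℝ^{n+1}, g_a^m(⟨ê,y⟩) = (a^m/Σ_n) Σ_{l=0}^{m+1} l! (α_l^m + α_l^{m+1}/λ) e^{-al} · C_l^λ(cos χ) / |y - rê|^{l+2λ}, where cos χ = ⟨y - rê, ê⟩ / |y - rê|. -/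
open Real MeasureTheory Set Filter
open scoped RealInnerProductSpace BigOperators

noncomputable def lamb (n : ℕ) : ℝ := ((n : ℝ) - 1) / 2

noncomputable def gegenbauer (lam : ℝ) (l : ℕ) (t : ℝ) : ℝ :=
  ∑ k ∈ Finset.range (l / 2 + 1),
    (-1 : ℝ) ^ k * Real.Gamma ((l : ℝ) - (k : ℝ) + lam) /
      (Real.Gamma lam * (Nat.factorial k : ℝ) * (Nat.factorial (l - 2 * k) : ℝ)) *
      (2 * t) ^ (l - 2 * k)

noncomputable def sigmaN (n : ℕ) : ℝ := 2 * Real.pi ^ (lamb n + 1) / Real.Gamma (lamb n + 1)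

noncomputable def pw (n : ℕ) (a : ℝ) (m : ℕ) (t : ℝ) : ℝ :=
  (1 / sigmaN n) * ∑' l : ℕ, ((lamb n + l) / lamb n) * (a * l) ^ m * Real.exp (-(a * l)) *
    gegenbauer (lamb n) l t

/-- The coefficients `α_l^m`: `alphaCoeff m l = α_l^m`. -/
def alphaCoeff : ℕ → ℕ → ℤ
  | 0, 0 => 1
  | 0, _ + 1 => 0
  | _ + 1, 0 => 0
  | m + 1, l + 1 => (l + 1) * alphaCoeff m (l + 1) + alphaCoeff m l

open scoped ComplexConjugate

/-- coefficients of the Gegenbauer polynomial, zero out of range. -/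
noncomputable def gc (lam : ℝ) (l k : ℕ) : ℝ :=
  if 2 * k ≤ l then (-1 : ℝ) ^ k * Real.Gamma ((l : ℝ) - (k : ℝ) + lam) /
      (Real.Gamma lam * (Nat.factorial k : ℝ) * (Nat.factorial (l - 2 * k) : ℝ)) else 0

lemma gc_zero (lam : ℝ) (hl : 0 < lam) (l : ℕ) :
    ((l : ℝ) + 1) * gc lam (l + 1) 0 = (l + lam) * gc lam l 0 := by
  have h1 : Real.Gamma ((l : ℝ) + 1 + lam) = (l + lam) * Real.Gamma (l + lam) := by
    rw [← Real.Gamma_add_one (by positivity)]; congr 1; ring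
  have h2 := (Real.Gamma_pos_of_pos hl).ne'
  have h3 : (Nat.factorial l : ℝ) ≠ 0 := by positivity
  simp only [gc]
  simp [h1, Nat.factorial_succ]
  field_simp

lemma gc_succ (lam : ℝ) (hl : 0 < lam) (l k : ℕ) :
    ((l : ℝ) + 1) * gc lam (l + 1) (k + 1) =
      ((l : ℝ) - (k + 1) + lam) * gc lam l (k + 1) - 2 * ((l - 2 * k : ℕ) : ℝ) * gc lam l k := by
  have h2 := (Real.Gamma_pos_of_pos hl).ne'
  have h3 : (Nat.factorial k : ℝ) ≠ 0 := by positivity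
  by_cases hA : 2 * k + 2 ≤ l
  · obtain ⟨d, rfl⟩ := Nat.exists_eq_add_of_le hA
    have e1 : 2 * k + 2 + d + 1 - 2 * (k + 1) = d + 1 := by omega
    have e2 : 2 * k + 2 + d - 2 * (k + 1) = d := by omega
    have e3 : 2 * k + 2 + d - 2 * k = d + 2 := by omega
    have h4 : (Nat.factorial d : ℝ) ≠ 0 := by positivity
    simp only [gc]
    rw [if_pos (by omega), if_pos (by omega), if_pos (by omega), e1, e2, e3]
    have g1 : Real.Gamma ((k : ℝ) + 2 + d + lam) =
        (k + 1 + d + lam) * Real.Gamma (k + 1 + d + lam) := by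
      rw [← Real.Gamma_add_one (by positivity)]; congr 1; ring
    push_cast [Nat.factorial_succ]
    rw [show (2 * (k : ℝ) + 2 + d + 1 - (k + 1) + lam) = k + 2 + d + lam by ring,
      show (2 * (k : ℝ) + 2 + d - (k + 1) + lam) = k + 1 + d + lam by ring,
      show (2 * (k : ℝ) + 2 + d - k + lam) = k + 2 + d + lam by ring, g1, pow_succ]
    field_simp
    ring
  · by_cases hB : 2 * k + 1 = l
    · subst hB
      have e1 : 2 * k + 1 + 1 - 2 * (k + 1) = 0 := by omega
      have e3 : 2 * k + 1 - 2 * k = 1 := by omega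
      simp only [gc]
      rw [if_pos (by omega), if_neg (by omega), if_pos (by omega), e1, e3]
      push_cast [Nat.factorial_succ]
      rw [show (2 * (k : ℝ) + 1 + 1 - (k + 1) + lam) = k + 1 + lam by ring,
        show (2 * (k : ℝ) + 1 - k + lam) = k + 1 + lam by ring, pow_succ]
      field_simp
      simp
      ring
    · have e3 : l - 2 * k = 0 := by omega
      simp only [gc]
      rw [if_neg (by omega), if_neg (by omega), e3]
      simp

lemma gegenbauer_eq (lam : ℝ) (l : ℕ) (t : ℝ) :
    gegenbauer lam l t = ∑ k ∈ Finset.range (l + 1), gc lam l k * (2 * t) ^ (l - 2 * k) := by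
  rw [gegenbauer]
  have hsub : Finset.range (l / 2 + 1) ⊆ Finset.range (l + 1) := by
    intro x hx; simp only [Finset.mem_range] at *; omega
  rw [← Finset.sum_subset hsub]
  · refine Finset.sum_congr rfl fun k hk => ?_
    simp only [Finset.mem_range] at hk
    rw [gc, if_pos (by omega)]
  · intro k _ hk
    simp only [Finset.mem_range] at hk
    rw [gc, if_neg (by omega), zero_mul]

noncomputable def Pc (w : ℂ) (s : ℝ) (z : ℂ) : ℂ :=
  (1 - z * w) ^ (-(s : ℂ)) * (1 - z * conj w) ^ (-(s : ℂ))

lemma re_pos_aux {w z : ℂ} (hw : ‖w‖ = 1) (hz : ‖z‖ < 1) : 0 < (1 - z * w).re := by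
  have h : (z * w).re ≤ ‖z * w‖ := Complex.re_le_norm _
  rw [norm_mul, hw, mul_one] at h
  simp only [Complex.sub_re, Complex.one_re]
  linarith

lemma Pc_deriv {w z : ℂ} (hw : ‖w‖ = 1) (hz : ‖z‖ < 1) (s : ℝ) :
    HasDerivAt (Pc w s) (s * (2 * (w.re - z)) * Pc w (s + 1) z) z := by
  have hw' : ‖conj w‖ = 1 := by simpa using hw
  have p1 := re_pos_aux hw hz
  have p2 := re_pos_aux hw' hz
  have n1 : (1 - z * w) ≠ 0 := by intro h; rw [h] at p1; simp at p1
  have n2 : (1 - z * conj w) ≠ 0 := by intro h; rw [h] at p2; simp at p2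
  have d1 : HasDerivAt (fun z : ℂ => 1 - z * w) (-(1 * w)) z :=
    ((hasDerivAt_id z).mul_const w).const_sub 1
  have d2 : HasDerivAt (fun z : ℂ => 1 - z * conj w) (-(1 * conj w)) z :=
    ((hasDerivAt_id z).mul_const (conj w)).const_sub 1
  have D := (d1.cpow_const (c := -(s : ℂ)) (Or.inl p1)).mul
    (d2.cpow_const (c := -(s : ℂ)) (Or.inl p2))
  have e1 : (1 - z * w) ^ (-(s : ℂ)) = (1 - z * w) ^ (-(s : ℂ) - 1) * (1 - z * w) := by
    rw [Complex.cpow_sub _ _ n1, Complex.cpow_one, div_mul_cancel₀ _ n1]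
  have e2 : (1 - z * conj w) ^ (-(s : ℂ)) =
      (1 - z * conj w) ^ (-(s : ℂ) - 1) * (1 - z * conj w) := by
    rw [Complex.cpow_sub _ _ n2, Complex.cpow_one, div_mul_cancel₀ _ n2]
  have e3 : w * conj w = 1 := by
    rw [Complex.mul_conj, Complex.normSq_eq_norm_sq, hw]; simp
  have e4 : 2 * (w.re : ℂ) = w + conj w := by
    rw [Complex.add_conj]; simp
  refine D.congr_deriv (Eq.symm ?_)
  rw [e1, e2, Pc]
  have e5 : -(((s + 1 : ℝ)) : ℂ) = -(s : ℂ) - 1 := by push_cast; ring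
  rw [e5]
  linear_combination (s * (1 - z * w) ^ (-(s : ℂ) - 1) * (1 - z * conj w) ^ (-(s : ℂ) - 1)) * e4
    - (-2 * z * s * (1 - z * w) ^ (-(s : ℂ) - 1) * (1 - z * conj w) ^ (-(s : ℂ) - 1)) * e3

noncomputable def Tc (lam : ℝ) (w : ℂ) (l k : ℕ) (z : ℂ) : ℂ :=
  gc lam l k * (2 * (w.re - z)) ^ (l - 2 * k) * Pc w ((l : ℝ) - k + lam) z

noncomputable def Gc (lam : ℝ) (w : ℂ) (l : ℕ) (z : ℂ) : ℂ :=
  ∑ k ∈ Finset.range (l + 1), Tc lam w l k z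

noncomputable def Ac (lam : ℝ) (w : ℂ) (l k : ℕ) (z : ℂ) : ℂ :=
  gc lam l k * ((l : ℝ) - k + lam : ℝ) * (2 * (w.re - z)) ^ (l + 1 - 2 * k) *
    Pc w ((l : ℝ) - k + lam + 1) z

noncomputable def Bc (lam : ℝ) (w : ℂ) (l k : ℕ) (z : ℂ) : ℂ :=
  -2 * ((l - 2 * k : ℕ) : ℂ) * gc lam l k * (2 * (w.re - z)) ^ (l - 2 * k - 1) *
    Pc w ((l : ℝ) - k + lam) z

lemma Tc_deriv (lam : ℝ) {w z : ℂ} (hw : ‖w‖ = 1) (hz : ‖z‖ < 1) (l k : ℕ) :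
    HasDerivAt (Tc lam w l k) (Ac lam w l k z + Bc lam w l k z) z := by
  have d1 : HasDerivAt (fun z : ℂ => 2 * ((w.re : ℂ) - z)) (2 * (-1)) z :=
    ((hasDerivAt_id z).const_sub (w.re : ℂ)).const_mul 2
  have D := ((d1.fun_pow (l - 2 * k)).const_mul (gc lam l k : ℂ)).mul
    (Pc_deriv hw hz ((l : ℝ) - k + lam))
  refine D.congr_deriv (Eq.symm ?_)
  rw [Ac, Bc]
  by_cases h : 2 * k ≤ l
  · rw [show l + 1 - 2 * k = (l - 2 * k) + 1 by omega, pow_succ]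
    ring
  · have : gc lam l k = 0 := by rw [gc, if_neg h]
    simp [this]

lemma Tc_zero (lam : ℝ) (hl : 0 < lam) (w z : ℂ) (l : ℕ) :
    ((l : ℂ) + 1) * Tc lam w (l + 1) 0 z = Ac lam w l 0 z := by
  have h := gc_zero lam hl l
  have h' : ((l : ℂ) + 1) * gc lam (l + 1) 0 = (l + lam) * gc lam l 0 := by exact_mod_cast h
  rw [Tc, Ac]
  have e : ((l + 1 : ℕ) : ℝ) - (0 : ℕ) + lam = (l : ℝ) - (0 : ℕ) + lam + 1 := by push_cast; ring
  rw [e]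
  have e' : (((l : ℝ) - (0 : ℕ) + lam : ℝ) : ℂ) = l + lam := by push_cast; ring
  rw [e']
  linear_combination (2 * (w.re - z)) ^ (l + 1 - 2 * 0) * Pc w ((l : ℝ) - (0 : ℕ) + lam + 1) z * h'

lemma Tc_succ (lam : ℝ) (hl : 0 < lam) (w z : ℂ) (l k : ℕ) :
    ((l : ℂ) + 1) * Tc lam w (l + 1) (k + 1) z = Ac lam w l (k + 1) z + Bc lam w l k z := by
  have h := gc_succ lam hl l k
  have h' : ((l : ℂ) + 1) * gc lam (l + 1) (k + 1) =
      ((l : ℂ) - (k + 1) + lam) * gc lam l (k + 1) - 2 * ((l - 2 * k : ℕ) : ℂ) * gc lam l k := by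
    exact_mod_cast congrArg (fun x : ℝ => (x : ℂ)) h
  rw [Tc, Ac, Bc]
  have e : ((l + 1 : ℕ) : ℝ) - (k + 1 : ℕ) + lam = (l : ℝ) - k + lam := by push_cast; ring
  have e' : (l : ℝ) - (k + 1 : ℕ) + lam + 1 = (l : ℝ) - k + lam := by push_cast; ring
  rw [e, e', show l + 1 - 2 * (k + 1) = l - 2 * k - 1 by omega]
  push_cast
  linear_combination (2 * (w.re - z)) ^ (l - 2 * k - 1) * Pc w ((l : ℝ) - k + lam) z * h'

lemma Gc_deriv (lam : ℝ) (hl : 0 < lam) {w z : ℂ} (hw : ‖w‖ = 1) (hz : ‖z‖ < 1) (l : ℕ) :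
    HasDerivAt (Gc lam w l) (((l : ℂ) + 1) * Gc lam w (l + 1) z) z := by
  have D := HasDerivAt.fun_sum (u := Finset.range (l + 1))
    (fun k _ => Tc_deriv lam hw hz l k)
  refine D.congr_deriv (Eq.symm ?_)
  rw [Gc, Finset.mul_sum, Finset.sum_range_succ', Tc_zero lam hl]
  simp_rw [Tc_succ lam hl]
  rw [Finset.sum_add_distrib, Finset.sum_add_distrib,
    Finset.sum_range_succ' (fun k => Ac lam w l k z)]
  have : Ac lam w l (l + 1) z = 0 := by
    have : gc lam l (l + 1) = 0 := by rw [gc, if_neg (by omega)]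
    simp [Ac, this]
  rw [Finset.sum_range_succ (fun k => Ac lam w l (k + 1) z), this]
  ring

lemma Gc_iter (lam : ℝ) (hl : 0 < lam) {w : ℂ} (hw : ‖w‖ = 1) (j l : ℕ) :
    ∀ z : ℂ, ‖z‖ < 1 → iteratedDeriv l (Gc lam w j) z =
      ((l + j).descFactorial l : ℂ) * Gc lam w (l + j) z := by
  induction l with
  | zero => intro z hz; simp
  | succ l ih =>
    intro z hz
    rw [iteratedDeriv_succ]
    have hev : iteratedDeriv l (Gc lam w j) =ᶠ[nhds z]
        fun z => ((l + j).descFactorial l : ℂ) * Gc lam w (l + j) z := by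
      have : Metric.ball (0 : ℂ) 1 ∈ nhds z := Metric.isOpen_ball.mem_nhds (by simpa using hz)
      filter_upwards [this] with x hx
      exact ih x (by simpa using hx)
    rw [hev.deriv_eq, ((Gc_deriv lam hl hw hz (l + j)).const_mul _).deriv]
    rw [show l + 1 + j = (l + j) + 1 by ring, Nat.succ_descFactorial_succ]
    push_cast
    ring

lemma Gc_hasSum (lam : ℝ) (hl : 0 < lam) {w z : ℂ} (hw : ‖w‖ = 1) (hz : ‖z‖ < 1) (j : ℕ) :
    HasSum (fun l : ℕ => ((l.descFactorial j : ℕ) : ℂ) * z ^ l * Gc lam w l 0)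
      (z ^ j * (j.factorial : ℂ) * Gc lam w j z) := by
  have hd : DifferentiableOn ℂ (Gc lam w j) (Metric.ball 0 1) := fun x hx =>
    (Gc_deriv lam hl hw (by simpa using hx) j).differentiableAt.differentiableWithinAt
  have H := Complex.hasSum_taylorSeries_on_ball hd (z := z) (by simpa using hz)
  have H2 := H.mul_left (z ^ j * (j.factorial : ℂ))
  have hs : ∑ i ∈ Finset.range j, ((i.descFactorial j : ℕ) : ℂ) * z ^ i * Gc lam w i 0 = 0 := by
    refine Finset.sum_eq_zero fun i hi => ?_
    rw [Nat.descFactorial_of_lt (Finset.mem_range.mp hi)]; simp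
  rw [← hasSum_nat_add_iff' j, hs, sub_zero]
  refine (congrArg (fun f : ℕ → ℂ => HasSum f _) (funext fun l => ?_)).mpr H2
  rw [Gc_iter lam hl hw j l 0 (by simp)]
  have e1 : (l.factorial : ℂ) * ((l + j).descFactorial j : ℂ) = ((l + j).factorial : ℂ) := by
    have := Nat.factorial_mul_descFactorial (Nat.le_add_left j l)
    rw [Nat.add_sub_cancel] at this
    exact_mod_cast this
  have e2 : (j.factorial : ℂ) * ((l + j).descFactorial l : ℂ) = ((l + j).factorial : ℂ) := by
    have := Nat.factorial_mul_descFactorial (Nat.le_add_right l j)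
    rw [Nat.add_sub_cancel_left] at this
    exact_mod_cast this
  have h0 : (l.factorial : ℂ) ≠ 0 := by exact_mod_cast l.factorial_ne_zero
  simp only [sub_zero, smul_eq_mul]
  rw [pow_add]
  field_simp
  linear_combination z ^ l * z ^ j * Gc lam w (l + j) 0 * (e1 - e2)

lemma alpha_zero_of_lt (m : ℕ) : ∀ l, m < l → alphaCoeff m l = 0 := by
  induction m with
  | zero => intro l hl; cases l with
    | zero => omega
    | succ l => simp [alphaCoeff]
  | succ m ih => intro l hl; cases l with
    | zero => omega
    | succ l => simp [alphaCoeff, ih l (by omega), ih (l + 1) (by omega)]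

lemma pow_eq_alpha (N x : ℕ) : ∀ m, m < N →
    ((x : ℤ)) ^ m = ∑ j ∈ Finset.range N, alphaCoeff m j * (x.descFactorial j : ℤ) := by
  intro m
  induction m with
  | zero =>
    intro hN
    obtain ⟨N, rfl⟩ : ∃ M, N = M + 1 := ⟨N - 1, by omega⟩
    rw [Finset.sum_range_succ']
    simp [alphaCoeff]
  | succ m ih =>
    intro hN
    rw [pow_succ, ih (by omega)]
    obtain ⟨N, rfl⟩ : ∃ M, N = M + 1 := ⟨N - 1, by omega⟩
    have key : ∀ j : ℕ, (x : ℤ) * (x.descFactorial j : ℤ) =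
        (x.descFactorial (j + 1) : ℤ) + j * (x.descFactorial j : ℤ) := by
      intro j
      rw [Nat.descFactorial_succ]
      by_cases h : j ≤ x
      · push_cast [h]; ring
      · rw [Nat.descFactorial_of_lt (by omega)]; simp
    have : ∀ j : ℕ, alphaCoeff m j * (x.descFactorial j : ℤ) * x =
      alphaCoeff m j * (x.descFactorial (j + 1) : ℤ) + j * alphaCoeff m j * (x.descFactorial j : ℤ) := by
      intro j; linear_combination alphaCoeff m j * key j
    rw [Finset.sum_mul]
    simp_rw [this]
    rw [Finset.sum_add_distrib, Finset.sum_range_succ, alpha_zero_of_lt m N (by omega),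
      Finset.sum_range_succ' (fun j : ℕ => (j : ℤ) * alphaCoeff m j * (x.descFactorial j : ℤ)),
      Finset.sum_range_succ']
    simp only [alphaCoeff]
    simp only [zero_mul, add_zero, Nat.cast_zero]
    rw [← Finset.sum_add_distrib]
    refine Finset.sum_congr rfl fun j _ => ?_
    push_cast
    ring

lemma Pc_real {w : ℂ} (hw : ‖w‖ = 1) {r : ℝ} (hr : ‖(r : ℂ)‖ < 1) (s : ℝ) :
    Pc w s r = ((1 - 2 * r * w.re + r ^ 2 : ℝ) ^ (-s) : ℝ) := by
  have p1 := re_pos_aux hw hr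
  have n1 : (1 - (r : ℂ) * w) ≠ 0 := by intro h; rw [h] at p1; simp at p1
  have harg : (1 - (r : ℂ) * w).arg ≠ Real.pi := by
    intro h
    have := (Complex.arg_eq_pi_iff.mp h).1
    linarith
  have e : (1 - (r : ℂ) * conj w) = conj (1 - (r : ℂ) * w) := by simp
  have e2 : (1 - (r : ℂ) * conj w) ^ (-(s : ℂ)) = conj ((1 - (r : ℂ) * w) ^ (-(s : ℂ))) := by
    rw [e, Complex.conj_cpow _ _ harg]; simp
  have hsq : w.re * w.re + w.im * w.im = 1 := by
    rw [← Complex.normSq_apply, Complex.normSq_eq_norm_sq, hw]; simp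
  have e3 : (1 - 2 * r * w.re + r ^ 2 : ℝ) = ‖1 - (r : ℂ) * w‖ ^ 2 := by
    rw [← Complex.normSq_eq_norm_sq, Complex.normSq_apply]
    simp
    linear_combination (-r ^ 2) * hsq
  rw [Pc, e2, Complex.mul_conj, Complex.normSq_eq_norm_sq, e3]
  have : (-(s : ℂ)) = ((-s : ℝ) : ℂ) := by push_cast; ring
  rw [this, Complex.norm_cpow_real]
  congr 1
  rw [← Real.rpow_natCast, ← Real.rpow_natCast, ← Real.rpow_mul (norm_nonneg _),
    ← Real.rpow_mul (norm_nonneg _), mul_comm (-s)]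

lemma Gc_real (lam : ℝ) {w : ℂ} (hw : ‖w‖ = 1) {r ρ : ℝ} (hr : ‖(r : ℂ)‖ < 1) (hρ : 0 < ρ)
    (h : ρ ^ 2 = 1 - 2 * r * w.re + r ^ 2) (l : ℕ) :
    Gc lam w l r = ((gegenbauer lam l ((w.re - r) / ρ) / ρ ^ ((l : ℝ) + 2 * lam) : ℝ) : ℂ) := by
  rw [Gc, gegenbauer_eq, Finset.sum_div, Complex.ofReal_sum]
  refine Finset.sum_congr rfl fun k _ => ?_
  rw [Tc, Pc_real hw hr, ← h]
  by_cases hk : 2 * k ≤ l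
  · have e1 : (ρ ^ 2 : ℝ) ^ (-((l : ℝ) - k + lam)) * ρ ^ (l - 2 * k) * ρ ^ ((l : ℝ) + 2 * lam) = 1 := by
      rw [← Real.rpow_natCast, ← Real.rpow_natCast, ← Real.rpow_mul hρ.le, ← Real.rpow_add hρ,
        ← Real.rpow_add hρ]
      push_cast [hk]
      ring_nf
      simp
    have h1 : ρ ^ (l - 2 * k) ≠ 0 := by positivity
    have h2 : ρ ^ ((l : ℝ) + 2 * lam) ≠ 0 := by positivity
    have : gc lam l k * (2 * (w.re - r)) ^ (l - 2 * k) * (ρ ^ 2 : ℝ) ^ (-((l : ℝ) - k + lam)) =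
       gc lam l k * (2 * ((w.re - r) / ρ)) ^ (l - 2 * k) / ρ ^ ((l : ℝ) + 2 * lam) := by
      rw [← mul_div_assoc, div_pow]
      field_simp
      linear_combination (gc lam l k * (2 * (w.re - r)) ^ (l - 2 * k)) * e1
    rw [← this]
    push_cast
    rfl
  · have : gc lam l k = 0 := by rw [gc, if_neg hk]
    simp [this]

lemma real_hasSum (lam : ℝ) (hl : 0 < lam) {t r ρ : ℝ} (ht : |t| ≤ 1) (hr : |r| < 1) (hρ : 0 < ρ)
    (h : ρ ^ 2 = 1 - 2 * r * t + r ^ 2) (j : ℕ) :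
    HasSum (fun l : ℕ => ((l.descFactorial j : ℕ) : ℝ) * r ^ l * gegenbauer lam l t)
      (r ^ j * (j.factorial : ℝ) *
        (gegenbauer lam j ((t - r) / ρ) / ρ ^ ((j : ℝ) + 2 * lam))) := by
  let w : ℂ := ⟨t, √(1 - t ^ 2)⟩
  have h1 : 0 ≤ 1 - t ^ 2 := by nlinarith [sq_abs t, abs_nonneg t]
  have hw : ‖w‖ = 1 := by
    have : ‖w‖ ^ 2 = 1 := by
      rw [← Complex.normSq_eq_norm_sq, Complex.normSq_apply]
      simp only [w]
      rw [Real.mul_self_sqrt h1]; ring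
    nlinarith [norm_nonneg w]
  have hr' : ‖(r : ℂ)‖ < 1 := by simpa using hr
  have H := Gc_hasSum lam hl hw hr' j
  rw [Gc_real lam hw hr' hρ h] at H
  have h0 : ∀ l, Gc lam w l 0 = ((gegenbauer lam l t : ℝ) : ℂ) := by
    intro l
    have := Gc_real lam hw (r := 0) (ρ := 1) (by simp) one_pos (by simp) l
    simpa [w] using this
  simp_rw [h0] at H
  exact_mod_cast H

lemma pow_hasSum (lam : ℝ) (hl : 0 < lam) {t r ρ : ℝ} (ht : |t| ≤ 1) (hr : |r| < 1) (hρ : 0 < ρ)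
    (h : ρ ^ 2 = 1 - 2 * r * t + r ^ 2) (m N : ℕ) (hN : m < N) :
    HasSum (fun l : ℕ => (l : ℝ) ^ m * r ^ l * gegenbauer lam l t)
      (∑ j ∈ Finset.range N, (alphaCoeff m j : ℝ) * (r ^ j * (j.factorial : ℝ) *
        (gegenbauer lam j ((t - r) / ρ) / ρ ^ ((j : ℝ) + 2 * lam)))) := by
  have H := hasSum_sum (s := Finset.range N)
    (fun j _ => (real_hasSum lam hl ht hr hρ h j).mul_left (alphaCoeff m j : ℝ))
  refine (congrArg (fun f : ℕ → ℝ => HasSum f _) (funext fun l => ?_)).mpr H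
  have := pow_eq_alpha N l m hN
  have h2 : (l : ℝ) ^ m = ∑ j ∈ Finset.range N, (alphaCoeff m j : ℝ) * (l.descFactorial j : ℝ) := by
    exact_mod_cast congrArg (fun x : ℤ => (x : ℝ)) this
  rw [h2, Finset.sum_mul, Finset.sum_mul]
  exact Finset.sum_congr rfl fun j _ => by ring

/-- the Poisson wavelet as a finite sum of multipole fields centered at the
source point `rê`, `r = e^{-a}`. -/
theorem stmt3 (n m : ℕ) (hn : 2 ≤ n) (hm : 1 ≤ m) (a : ℝ) (ha : 0 < a)
    (e y : EuclideanSpace ℝ (Fin (n + 1))) (he : e = EuclideanSpace.single 0 1)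
    (hy : ‖y‖ = 1) :
    pw n a m ⟪e, y⟫
      = a ^ m / sigmaN n *
          ∑ l ∈ Finset.range (m + 2),
            (Nat.factorial l : ℝ) *
              ((alphaCoeff m l : ℝ) + (alphaCoeff (m + 1) l : ℝ) / lamb n) *
              Real.exp (-(a * l)) *
              gegenbauer (lamb n) l
                (⟪y - Real.exp (-a) • e, e⟫ / ‖y - Real.exp (-a) • e‖) /
              ‖y - Real.exp (-a) • e‖ ^ ((l : ℝ) + 2 * lamb n) := by
  have hlam : 0 < lamb n := by
    have : (2 : ℝ) ≤ n := by exact_mod_cast hn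
    rw [lamb]; linarith
  have he1 : ‖e‖ = 1 := by rw [he]; simp
  set t : ℝ := ⟪e, y⟫ with htdef
  set r : ℝ := Real.exp (-a) with hrdef
  have hr0 : 0 < r := Real.exp_pos _
  have hr1 : r < 1 := by rw [hrdef]; simpa using ha
  have ht : |t| ≤ 1 := by
    have := abs_real_inner_le_norm e y
    rwa [he1, hy, one_mul] at this
  have hin : ⟪y - r • e, e⟫ = t - r := by
    rw [inner_sub_left, inner_smul_left, real_inner_self_eq_norm_sq, he1, real_inner_comm]
    simp [htdef]
  have hnorm : ‖y - r • e‖ ^ 2 = 1 - 2 * r * t + r ^ 2 := by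
    rw [norm_sub_sq_real, inner_smul_right, norm_smul, he1, hy, real_inner_comm, Real.norm_eq_abs]
    simp [htdef]
    ring
  have hpos : 0 < ‖y - r • e‖ := by
    rw [norm_pos_iff]
    intro h0
    have : y = r • e := sub_eq_zero.mp h0
    have h2 : ‖y‖ = r := by rw [this, norm_smul, he1, Real.norm_eq_abs, abs_of_pos hr0, mul_one]
    linarith
  rw [hin]
  set ρ : ℝ := ‖y - r • e‖ with hρdef
  have hr : |r| < 1 := by rwa [abs_of_pos hr0]
  have hexp : ∀ l : ℕ, Real.exp (-(a * l)) = r ^ l := by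
    intro l; rw [hrdef, ← Real.exp_nat_mul]; congr 1; ring
  have H1 := pow_hasSum (lamb n) hlam ht hr hpos hnorm m (m + 2) (by omega)
  have H2 := pow_hasSum (lamb n) hlam ht hr hpos hnorm (m + 1) (m + 2) (by omega)
  have H := (H1.add (H2.mul_left (1 / lamb n))).mul_left (a ^ m)
  have hts : ∑' l : ℕ, ((lamb n + l) / lamb n) * (a * l) ^ m * Real.exp (-(a * l)) *
      gegenbauer (lamb n) l t = ∑' l : ℕ, a ^ m * ((l : ℝ) ^ m * r ^ l * gegenbauer (lamb n) l t +
        1 / lamb n * ((l : ℝ) ^ (m + 1) * r ^ l * gegenbauer (lamb n) l t)) := by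
    refine tsum_congr fun l => ?_
    rw [hexp]
    field_simp
    rw [mul_pow]
    ring
  rw [pw, hts, H.tsum_eq, Finset.mul_sum, ← Finset.sum_add_distrib, ← mul_assoc]
  congr 1
  · ring
  · refine Finset.sum_congr rfl fun l _ => ?_
    rw [hexp]
    ring
end

section
/- Let n ≥ 2 be an integer, λ = (n-1)/2, ê = (1,0,…,0) ∈ ℝ^{n+1}, m ∈ ℕ, and let x ∈ ℝ^{n+1}, x ≠ 0. For 0 < r < |x|, applying the operator (r∂_r)^m + (1/λ)(r∂_r)^{m+1} (where (r∂_r) denotes f ↦ r·∂f/∂r in the variable r) to the function r ↦ (|x|² - 2r⟨x,ê⟩ + r²)^{-λ} yields |x|^{-2λ} Σ_{l=0}^∞ ((λ+l)/λ) l^m (r/|x|)^l C_l^λ(cos θ), where cos θ = ⟨x,ê⟩/|x|, and the series converges absolutely. -/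
open Real MeasureTheory Set Filter
open scoped RealInnerProductSpace BigOperators

/-- The operator `f ↦ (r ↦ r·f'(r))`. -/
noncomputable def rD : (ℝ → ℝ) → (ℝ → ℝ) := fun f r => r * deriv f r

lemma aux_series {a : ℕ → ℝ} {f : ℝ → ℝ} {R : ℝ} (hR : 0 < R)
    (h : ∀ s : ℝ, |s| < R → HasSum (fun l => a l * s ^ l) (f s)) :
    HasFPowerSeriesOnBall f (FormalMultilinearSeries.ofScalars ℝ a) 0 (ENNReal.ofReal R) := by
  refine ⟨?_, by simpa using hR, ?_⟩
  · refine ENNReal.le_of_forall_nnreal_lt fun r hr => ?_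
    apply FormalMultilinearSeries.le_radius_of_summable
    have hr' : |(r : ℝ)| < R := by
      rw [abs_of_nonneg (NNReal.coe_nonneg r)]
      rw [← ENNReal.ofReal_coe_nnreal] at hr
      exact (ENNReal.ofReal_lt_ofReal_iff hR).1 hr
    have := (h r hr').summable.norm
    refine this.congr fun n => ?_
    rw [FormalMultilinearSeries.ofScalars_norm]
    simp
  · intro y hy
    have hy' : |y| < R := by simpa [edist_dist, Real.dist_eq] using hy
    simpa [FormalMultilinearSeries.ofScalars_apply_eq, mul_comm] using h y hy'

lemma aux_rD {a : ℕ → ℝ} {f : ℝ → ℝ} {R : ℝ} (hR : 0 < R)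
    (h : ∀ s : ℝ, |s| < R → HasSum (fun l => a l * s ^ l) (f s)) (s : ℝ) (hs : |s| < R) :
    HasSum (fun l : ℕ => (l : ℝ) * a l * s ^ l) (rD f s) := by
  have H := (aux_series hR h).fderiv
  have hs' : s ∈ Metric.eball (0 : ℝ) (ENNReal.ofReal R) := by
    simpa [edist_dist, Real.dist_eq] using hs
  have H1 := H.hasSum hs'
  have H2 := (ContinuousLinearMap.apply ℝ ℝ s).hasSum H1
  rw [← hasSum_nat_add_iff' 1]
  convert H2 using 1
  · ext n
    rw [ContinuousLinearMap.apply_apply, FormalMultilinearSeries.derivSeries_apply_diag,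
      FormalMultilinearSeries.ofScalars_apply_eq]
    simp [mul_assoc]
  · simp [rD, mul_comm]

lemma aux_rD_iter {a : ℕ → ℝ} {f : ℝ → ℝ} {R : ℝ} (hR : 0 < R)
    (h : ∀ s : ℝ, |s| < R → HasSum (fun l => a l * s ^ l) (f s)) (m : ℕ) : ∀ (s : ℝ), |s| < R →
    HasSum (fun l : ℕ => ((l : ℝ) ^ m * a l) * s ^ l) (rD^[m] f s) := by
  induction m with
  | zero => simpa using h
  | succ m ih =>
    intro s hs
    rw [Function.iterate_succ_apply']
    convert aux_rD hR ih s hs using 2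
    ring

lemma aux_unique {a b : ℕ → ℝ} {f : ℝ → ℝ} {R S : ℝ} (hR : 0 < R) (hS : 0 < S)
    (h : ∀ s : ℝ, |s| < R → HasSum (fun l => a l * s ^ l) (f s))
    (h' : ∀ s : ℝ, |s| < S → HasSum (fun l => b l * s ^ l) (f s)) : a = b := by
  have := (aux_series hR h).hasFPowerSeriesAt.eq_formalMultilinearSeries
    (aux_series hS h').hasFPowerSeriesAt
  exact FormalMultilinearSeries.ofScalars_series_injective ℝ ℝ this

lemma aux_coef {lam : ℝ} (hl : 0 < lam) (j : ℕ) :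
    Ring.choose (lam + j - 1) j = Real.Gamma (j + lam) / (Real.Gamma lam * (j.factorial : ℝ)) := by
  rw [← Ring.multichoose_eq]
  have h1 := Ring.factorial_nsmul_multichoose_eq_ascPochhammer lam j
  have h2 : (ascPochhammer ℕ j).smeval lam * Real.Gamma lam = Real.Gamma (j + lam) := by
    rw [Polynomial.ascPochhammer_smeval_eq_eval]
    induction j with
    | zero => simp
    | succ j ih =>
      rw [ascPochhammer_succ_eval]
      have : Real.Gamma ((j + 1 : ℕ) + lam) = (j + lam) * Real.Gamma (j + lam) := by
        rw [← Real.Gamma_add_one (by positivity)]; congr 1; push_cast; ring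
      rw [this, ← ih (Ring.factorial_nsmul_multichoose_eq_ascPochhammer lam j)]; ring
  have := Real.Gamma_pos_of_pos hl
  rw [nsmul_eq_mul] at h1
  rw [← h2, ← h1]
  field_simp

lemma aux_binom {lam : ℝ} (hl : 0 < lam) (y : ℝ) (hy : |y| < 1) :
    HasSum (fun j : ℕ => Real.Gamma (j + lam) / (Real.Gamma lam * (j.factorial : ℝ)) * y ^ j)
      ((1 - y) ^ (-lam)) := by
  have H := Real.one_div_one_sub_rpow_hasFPowerSeriesOnBall_zero lam
  have hy' : y ∈ Metric.eball (0 : ℝ) 1 := by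
    have : ENNReal.ofReal |y| < 1 := by simpa using hy
    simpa [edist_dist, Real.dist_eq] using this
  have := H.hasSum hy'
  rw [abs_lt] at hy
  rw [Real.rpow_neg (by linarith)]
  simpa [FormalMultilinearSeries.ofScalars_apply_eq, aux_coef hl, mul_comm] using this

/-- the double series term -/
noncomputable def auxT (lam A B : ℝ) (p : ℕ × ℕ) : ℝ :=
  Real.Gamma ((p.1 + p.2 : ℕ) + lam) / (Real.Gamma lam * ((p.1 + p.2).factorial : ℝ)) *
    (A ^ p.1 * B ^ p.2 * ((p.1 + p.2).choose p.1 : ℝ))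

lemma auxT_anti (lam A B : ℝ) (j : ℕ) : ∑ p ∈ Finset.HasAntidiagonal.antidiagonal j, auxT lam A B p =
    Real.Gamma (j + lam) / (Real.Gamma lam * (j.factorial : ℝ)) * (A + B) ^ j := by
  rw [(Commute.all A B).add_pow', Finset.mul_sum]
  refine Finset.sum_congr rfl fun p hp => ?_
  rw [Finset.HasAntidiagonal.mem_antidiagonal] at hp
  simp only [auxT, hp, nsmul_eq_mul]
  ring

lemma auxT_summable {lam : ℝ} (hl : 0 < lam) {A B : ℝ} (h : |A| + |B| < 1) :
    Summable (auxT lam A B) := by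
  have key : Summable (auxT lam |A| |B|) := by
    have hnn : ∀ p, 0 ≤ auxT lam |A| |B| p := fun p => by
      have := Real.Gamma_pos_of_pos hl
      have : 0 < Real.Gamma ((p.1 + p.2 : ℕ) + lam) := Real.Gamma_pos_of_pos (by positivity)
      unfold auxT; positivity
    rw [← Finset.HasAntidiagonal.sigmaAntidiagonalEquivProd.summable_iff]
    refine (summable_sigma_of_nonneg (fun _ => hnn _)).2 ?_
    refine ⟨fun n => (hasSum_fintype _).summable, ?_⟩
    have := (aux_binom hl (|A| + |B|) (by rwa [abs_of_nonneg (by positivity)])).summable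
    refine this.congr fun j => ?_
    rw [← auxT_anti, tsum_fintype, ← Finset.sum_coe_sort]
    rfl
  refine Summable.of_norm (key.congr fun p => ?_)
  have := Real.Gamma_pos_of_pos hl
  have : 0 < Real.Gamma ((p.1 + p.2 : ℕ) + lam) := Real.Gamma_pos_of_pos (by positivity)
  simp only [auxT, norm_mul, norm_pow, norm_div, Real.norm_eq_abs]
  simp only [Nat.abs_cast]
  rw [abs_of_pos this, abs_of_pos (Real.Gamma_pos_of_pos hl)]

lemma auxT_hasSum {lam : ℝ} (hl : 0 < lam) {A B : ℝ} (h : |A| + |B| < 1) :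
    HasSum (auxT lam A B) ((1 - (A + B)) ^ (-lam)) := by
  have hs := auxT_summable hl h
  convert hs.hasSum using 1
  have hb := aux_binom hl (A + B) ((abs_add_le A B).trans_lt h)
  rw [← hb.tsum_eq, ← Finset.HasAntidiagonal.sigmaAntidiagonalEquivProd.tsum_eq]
  refine Eq.trans ?_ (Summable.tsum_sigma' (fun n => (hasSum_fintype _).summable)
    ((Finset.HasAntidiagonal.sigmaAntidiagonalEquivProd.summable_iff).2 hs)).symm
  refine tsum_congr fun j => ?_
  rw [← auxT_anti, tsum_fintype, ← Finset.sum_coe_sort]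
  rfl

lemma aux_small {lam : ℝ} (hl : 0 < lam) {t s : ℝ} (h : |2 * t * s| + |-s ^ 2| < 1) :
    HasSum (fun l => gegenbauer lam l t * s ^ l) ((1 - 2 * t * s + s ^ 2) ^ (-lam)) := by
  have H := auxT_hasSum hl h
  let g : ℕ × ℕ → ℕ × ℕ := fun p => (p.1 + 2 * p.2, p.2)
  have hg : Function.Injective g := by
    rintro ⟨a, b⟩ ⟨c, d⟩ h
    simp only [g, Prod.mk.injEq] at h ⊢
    omega
  let T' : ℕ × ℕ → ℝ := fun q =>
    if 2 * q.2 ≤ q.1 then auxT lam (2 * t * s) (-s ^ 2) (q.1 - 2 * q.2, q.2) else 0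
  have hT : T' ∘ g = auxT lam (2 * t * s) (-s ^ 2) := by
    ext ⟨a, b⟩
    simp [T', g]
  rw [← hT, hg.hasSum_iff] at H
  · have e1 : 1 - (2 * t * s + -s ^ 2) = 1 - 2 * t * s + s ^ 2 := by ring
    rw [e1] at H
    refine H.prod_fiberwise fun l => ?_
    have : gegenbauer lam l t * s ^ l = ∑ k ∈ Finset.range (l / 2 + 1), T' (l, k) := by
      rw [gegenbauer, Finset.sum_mul]
      refine Finset.sum_congr rfl fun k hk => ?_
      rw [Finset.mem_range] at hk
      have hk' : 2 * k ≤ l := by omega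
      simp only [T', hk', if_true, auxT]
      obtain ⟨i, rfl⟩ := Nat.exists_eq_add_of_le hk'
      have e2 : 2 * k + i - 2 * k = i := by omega
      rw [e2]
      have e3 : ((2 * k + i : ℕ) : ℝ) - k + lam = ((i + k : ℕ) : ℝ) + lam := by push_cast; ring
      rw [e3]
      have e4 : ((i + k).choose i : ℝ) = (i + k).factorial / (i.factorial * k.factorial) := by
        rw [Nat.cast_add_choose]
      rw [e4]
      have := Real.Gamma_pos_of_pos hl
      have e5 : (-s ^ 2) ^ k = (-1) ^ k * s ^ (2 * k) := by
        rw [neg_eq_neg_one_mul, mul_pow, pow_mul]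
      rw [e5, pow_add, mul_pow (2 * t)]
      have := Nat.factorial_pos (i + k)
      field_simp
    rw [this]
    refine hasSum_sum_of_ne_finset_zero fun k hk => ?_
    rw [Finset.mem_range] at hk
    simp only [T']
    rw [if_neg (by omega)]
  · rintro ⟨l, k⟩ hq
    simp only [T']
    rw [if_neg]
    intro hle
    exact hq ⟨(l - 2 * k, k), by simp only [g, Prod.mk.injEq, and_true]; change 2 * k ≤ l at hle; omega⟩

lemma aux_big (lam : ℝ) {t : ℝ} (ht : |t| ≤ 1) :
    ∃ c : ℕ → ℝ, ∀ s : ℝ, |s| < 1 → HasSum (fun l => c l * s ^ l) ((1 - 2 * t * s + s ^ 2) ^ (-lam)) := by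
  let w : ℂ := ⟨t, √(1 - t ^ 2)⟩
  have ht2 : 0 ≤ 1 - t ^ 2 := by
    have := (sq_le_one_iff_abs_le_one t).2 ht
    linarith
  have hw : Complex.normSq w = 1 := by
    simp only [w, Complex.normSq_mk, Real.mul_self_sqrt ht2]; ring
  have hwn : ‖w‖ = 1 := by
    rw [← Complex.sq_norm] at hw
    nlinarith [norm_nonneg w]
  let v : ℂ := (starRingEnd ℂ) w
  have hvn : ‖v‖ = 1 := by simp [v, hwn]
  have slit : ∀ u : ℂ, ‖u‖ = 1 → ∀ z ∈ Metric.ball (0 : ℂ) 1, 1 - z * u ∈ Complex.slitPlane := by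
    intro u hu z hz
    left
    have h1 : ‖z * u‖ < 1 := by rw [norm_mul, hu, mul_one]; simpa using hz
    have h2 := (Complex.abs_re_le_norm (z * u)).trans_lt h1
    rw [abs_lt] at h2
    rw [Complex.sub_re, Complex.one_re]; linarith
  let F : ℂ → ℂ := fun z => (1 - z * w) ^ (-(lam : ℂ)) * (1 - z * v) ^ (-(lam : ℂ))
  have hF : DifferentiableOn ℂ F (Metric.ball 0 1) := by
    refine DifferentiableOn.mul ?_ ?_
    · exact DifferentiableOn.cpow (by fun_prop) (by fun_prop) (slit w hwn)
    · exact DifferentiableOn.cpow (by fun_prop) (by fun_prop) (slit v hvn)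
  refine ⟨fun n => (((n.factorial : ℂ)⁻¹ * iteratedDeriv n F 0)).re, fun s hs => ?_⟩
  have hsb : (s : ℂ) ∈ Metric.ball (0 : ℂ) 1 := by simpa using hs
  have H := Complex.hasSum_re (Complex.hasSum_taylorSeries_on_ball hF hsb)
  convert H using 1
  · ext n
    rw [sub_zero, smul_eq_mul, smul_eq_mul, mul_left_comm, ← Complex.ofReal_pow,
      Complex.re_ofReal_mul, mul_comm]
  · have hconj : 1 - (s : ℂ) * v = (starRingEnd ℂ) (1 - (s : ℂ) * w) := by simp [v]
    have hz := slit w hwn s hsb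
    have hn : Complex.normSq (1 - (s : ℂ) * w) = 1 - 2 * t * s + s ^ 2 := by
      have : Complex.normSq (1 - (s : ℂ) * w) = 1 - 2 * t * s + s ^ 2 * Complex.normSq w := by
        simp [Complex.normSq_apply, w]; ring
      rw [this, hw, mul_one]
    have e : F s = ((Complex.normSq ((1 - (s : ℂ) * w) ^ (-(lam : ℂ))) : ℝ) : ℂ) := by
      simp only [F]
      rw [hconj, ← Complex.mul_conj, Complex.conj_cpow _ _ (Complex.slitPlane_arg_ne_pi hz)]
      simp
    rw [e, Complex.ofReal_re, ← hn, ← Complex.sq_norm, ← Complex.sq_norm]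
    rw [← Complex.ofReal_neg, Complex.norm_cpow_real, ← Real.rpow_natCast, ← Real.rpow_natCast,
      ← Real.rpow_mul (norm_nonneg _), ← Real.rpow_mul (norm_nonneg _), mul_comm (-lam)]

lemma aux_gen {lam : ℝ} (hl : 0 < lam) {t : ℝ} (ht : |t| ≤ 1) (s : ℝ) (hs : |s| < 1) :
    HasSum (fun l => gegenbauer lam l t * s ^ l) ((1 - 2 * t * s + s ^ 2) ^ (-lam)) := by
  obtain ⟨c, hc⟩ := aux_big lam ht
  have hsm : ∀ s : ℝ, |s| < 1 / 4 →
      HasSum (fun l => gegenbauer lam l t * s ^ l) ((1 - 2 * t * s + s ^ 2) ^ (-lam)) := by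
    intro s hs
    refine aux_small hl ?_
    rw [abs_neg, abs_pow, abs_mul, abs_mul, abs_two]
    nlinarith [abs_nonneg s, abs_nonneg t]
  have := aux_unique (by norm_num) one_pos hsm hc
  have h2 := hc s hs
  rw [← this] at h2
  exact h2

/-- expansion around the origin of the harmonically extended Poisson wavelet:
applying `(r∂_r)^m + (1/λ)(r∂_r)^{m+1}` to `r ↦ (|x|²-2r⟨x,ê⟩+r²)^{-λ}` gives
`|x|^{-2λ} Σ_l ((λ+l)/λ) l^m (r/|x|)^l C_l^λ(cos θ)`, the series converging absolutely. -/
theorem stmt4 (n m : ℕ) (hn : 2 ≤ n) (hm : 1 ≤ m)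
    (e x : EuclideanSpace ℝ (Fin (n + 1))) (he : e = EuclideanSpace.single 0 1)
    (hx : x ≠ 0) (r : ℝ) (hr0 : 0 < r) (hr : r < ‖x‖) :
    Summable (fun l : ℕ =>
      |((lamb n + l) / lamb n) * (l : ℝ) ^ m * (r / ‖x‖) ^ l *
        gegenbauer (lamb n) l (⟪x, e⟫ / ‖x‖)|) ∧
    rD^[m] (fun s : ℝ => (‖x‖ ^ 2 - 2 * s * ⟪x, e⟫ + s ^ 2) ^ (-(lamb n))) r +
      (1 / lamb n) *
        rD^[m + 1] (fun s : ℝ => (‖x‖ ^ 2 - 2 * s * ⟪x, e⟫ + s ^ 2) ^ (-(lamb n))) r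
      = ‖x‖ ^ (-(2 * lamb n)) *
          ∑' l : ℕ, ((lamb n + l) / lamb n) * (l : ℝ) ^ m * (r / ‖x‖) ^ l *
            gegenbauer (lamb n) l (⟪x, e⟫ / ‖x‖) := by
  have hl : 0 < lamb n := by
    have : (2 : ℝ) ≤ n := by exact_mod_cast hn
    unfold lamb; linarith
  have hX : 0 < ‖x‖ := norm_pos_iff.2 hx
  have he1 : ‖e‖ = 1 := by simp [he]
  have ht : |⟪x, e⟫ / ‖x‖| ≤ 1 := by
    rw [abs_div, abs_norm, div_le_one hX]
    simpa [he1] using abs_real_inner_le_norm x e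
  set q : ℝ := ⟪x, e⟫ with hq
  set X : ℝ := ‖x‖ with hXd
  have base : ∀ s : ℝ, |s| < X →
      HasSum (fun l => (X ^ (-(2 * lamb n)) * (gegenbauer (lamb n) l (q / X) / X ^ l)) * s ^ l)
        ((fun s : ℝ => (X ^ 2 - 2 * s * q + s ^ 2) ^ (-(lamb n))) s) := by
    intro s hs
    have hs1 : |s / X| < 1 := by rwa [abs_div, abs_of_pos hX, div_lt_one hX]
    have H := (aux_gen hl ht (s / X) hs1).mul_left (X ^ (-(2 * lamb n)))
    convert! H using 1
    · ext l; rw [div_pow]; ring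
    · have e1 : X ^ 2 - 2 * s * q + s ^ 2 =
          X ^ 2 * (1 - 2 * (q / X) * (s / X) + (s / X) ^ 2) := by field_simp
      have hp : 0 ≤ 1 - 2 * (q / X) * (s / X) + (s / X) ^ 2 := by
        have := (sq_le_one_iff_abs_le_one _).2 ht
        nlinarith [sq_nonneg (s / X - q / X)]
      beta_reduce
      rw [e1, Real.mul_rpow (by positivity) hp, ← Real.rpow_natCast, ← Real.rpow_mul hX.le]
      congr 2; push_cast; ring
  have hrX : |r| < X := by rwa [abs_of_pos hr0]
  have h1 := aux_rD_iter hX base m r hrX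
  have h2 := (aux_rD_iter hX base (m + 1) r hrX).mul_left (1 / lamb n)
  have h3 := h1.add h2
  have hc : X ^ (-(2 * lamb n)) ≠ 0 := (Real.rpow_pos_of_pos hX _).ne'
  have hfun : (fun l : ℕ => (l : ℝ) ^ m * (X ^ (-(2 * lamb n)) *
      (gegenbauer (lamb n) l (q / X) / X ^ l)) * r ^ l + 1 / lamb n * ((l : ℝ) ^ (m + 1) *
      (X ^ (-(2 * lamb n)) * (gegenbauer (lamb n) l (q / X) / X ^ l)) * r ^ l)) =
      (fun l : ℕ => X ^ (-(2 * lamb n)) * (((lamb n + l) / lamb n) * (l : ℝ) ^ m *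
      (r / X) ^ l * gegenbauer (lamb n) l (q / X))) := by
    funext l
    rw [div_pow]
    have hXl : X ^ l ≠ 0 := pow_ne_zero _ hX.ne'
    generalize X ^ (-(2 * lamb n)) = c
    generalize gegenbauer (lamb n) l (q / X) = G
    field_simp
    ring
  have h4 := h3
  rw [hfun] at h4
  have h5 := (summable_mul_left_iff hc).1 h4.summable
  exact ⟨h5.abs, by rw [← tsum_mul_left, h4.tsum_eq]⟩
end

section
/- Let n ≥ 2 be an integer, λ = (n-1)/2, and m ∈ ℕ. There exists a constant c such that |a^n · g_a^m(cos(aθ))| ≤ c·e^{-a}/θ^{m+n} for all a > 0 and all θ ∈ (0, π/a]; moreover, m+n is the largest possible exponent in this inequality, i.e. for every κ > m+n there is no constant c with |a^n · g_a^m(cos(aθ))| ≤ c·e^{-a}/θ^κ for all a > 0 and θ ∈ (0,π/a]. -/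
open Real MeasureTheory Set Filter
open scoped RealInnerProductSpace BigOperators

/-- binomial coefficient in Gamma form -/
noncomputable def pcoef (lam : ℝ) (j : ℕ) : ℝ :=
  Real.Gamma ((j : ℝ) + lam) / (Real.Gamma lam * (Nat.factorial j : ℝ))

lemma pcoef_pos {lam : ℝ} (h : 0 < lam) (j : ℕ) : 0 < pcoef lam j := by
  unfold pcoef
  have h1 : 0 < Real.Gamma lam := Real.Gamma_pos_of_pos h
  have h2 : 0 < Real.Gamma (j + lam) := Real.Gamma_pos_of_pos (by positivity)
  positivity

lemma choose_pcoef {lam : ℝ} (h : 0 < lam) (j : ℕ) :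
    Ring.choose ((lam : ℂ) + j - 1) j = (pcoef lam j : ℂ) := by
  have h0 : (j.factorial : ℂ) ≠ 0 := by exact_mod_cast j.factorial_ne_zero
  have h1 : Ring.choose ((lam : ℂ) + j - 1) j = Ring.multichoose (lam : ℂ) j := by
    unfold Ring.choose
    congr 1; ring
  have h2 := Ring.factorial_nsmul_multichoose_eq_ascPochhammer (lam : ℂ) j
  rw [Polynomial.ascPochhammer_smeval_eq_eval, ← Complex.Gamma_add_nat_div_Gamma_eq] at h2
  · rw [h1]
    rw [nsmul_eq_mul] at h2
    have h3 : Complex.Gamma lam ≠ 0 := by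
      rw [Complex.Gamma_ofReal]
      exact_mod_cast (Real.Gamma_pos_of_pos h).ne'
    unfold pcoef
    push_cast
    rw [← Complex.Gamma_ofReal, ← Complex.Gamma_ofReal]
    push_cast
    rw [add_comm (j : ℂ)]
    field_simp at h2 ⊢
    linear_combination h2
  · intro k hk
    have : lam = -k := by exact_mod_cast hk
    have : (0 : ℝ) ≤ k := by positivity
    linarith

lemma hasSum_binom {lam : ℝ} (h : 0 < lam) (x : ℂ) (hx : ‖x‖ < 1) :
    HasSum (fun j : ℕ => (pcoef lam j : ℂ) * x ^ j) (1 / (1 - x) ^ (lam : ℂ)) := by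
  have := (Complex.one_div_one_sub_cpow_hasFPowerSeriesOnBall_zero (lam : ℂ)).hasSum (y := x)
    (by simpa [Metric.mem_eball, edist_zero_right, enorm_eq_nnnorm] using
      (show ‖x‖₊ < 1 from hx))
  simpa [FormalMultilinearSeries.ofScalars_apply_eq, choose_pcoef h, mul_comm] using this

/-- double series term -/
noncomputable def dterm (lam : ℝ) (x y : ℂ) (q : ℕ × ℕ) : ℂ :=
  (pcoef lam (q.1 + q.2) : ℂ) * ((Nat.choose (q.1 + q.2) q.1 : ℂ) * (x ^ q.1 * y ^ q.2))

lemma dterm_antidiag (lam : ℝ) (x y : ℂ) (j : ℕ) :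
    ∑ q ∈ Finset.HasAntidiagonal.antidiagonal j, dterm lam x y q = (pcoef lam j : ℂ) * (x + y) ^ j := by
  rw [(Commute.all x y).add_pow', Finset.mul_sum]
  refine Finset.sum_congr rfl fun q hq => ?_
  rw [Finset.HasAntidiagonal.mem_antidiagonal] at hq
  simp [dterm, hq]

lemma dterm_norm {lam : ℝ} (h : 0 < lam) (x y : ℂ) (q : ℕ × ℕ) :
    (‖dterm lam x y q‖ : ℂ) = dterm lam (‖x‖ : ℂ) (‖y‖ : ℂ) q := by
  simp [dterm, abs_of_pos (pcoef_pos h _)]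

lemma dterm_summable {lam : ℝ} (h : 0 < lam) (x y : ℂ) (hxy : ‖x‖ + ‖y‖ < 1) :
    Summable (fun q => ‖dterm lam x y q‖) := by
  rw [← Finset.HasAntidiagonal.sigmaAntidiagonalEquivProd.summable_iff]
  refine (summable_sigma_of_nonneg (fun b => by exact norm_nonneg _)).mpr ⟨fun j => (hasSum_fintype _).summable, ?_⟩
  have key : ∀ j : ℕ, (∑' q : Finset.HasAntidiagonal.antidiagonal j, ‖dterm lam x y q‖) =
      pcoef lam j * (‖x‖ + ‖y‖) ^ j := by
    intro j
    rw [tsum_fintype, Finset.sum_coe_sort (Finset.HasAntidiagonal.antidiagonal j) (fun q => ‖dterm lam x y q‖)]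
    have := dterm_antidiag lam (‖x‖ : ℂ) (‖y‖ : ℂ) j
    simp_rw [← dterm_norm h] at this
    exact_mod_cast this
  have h2 := hasSum_binom h ((‖x‖ + ‖y‖ : ℝ) : ℂ) (by
    rw [Complex.norm_real, Real.norm_of_nonneg (by positivity)]; exact hxy)
  have h3 : Summable (fun j : ℕ => pcoef lam j * (‖x‖ + ‖y‖) ^ j) := by
    have := h2.summable
    exact_mod_cast this
  convert h3 using 2 with j
  exact key j

lemma dterm_hasSum {lam : ℝ} (h : 0 < lam) (x y : ℂ) (hxy : ‖x‖ + ‖y‖ < 1) :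
    HasSum (dterm lam x y) (1 / (1 - (x + y)) ^ (lam : ℂ)) := by
  have hs : Summable (dterm lam x y) := (dterm_summable h x y hxy).of_norm
  have h1 := hs.hasSum
  rw [← Finset.HasAntidiagonal.sigmaAntidiagonalEquivProd.hasSum_iff] at h1
  have h2 := h1.sigma (fun j => hasSum_fintype _)
  have h3 := hasSum_binom h (x + y) ((norm_add_le _ _).trans_lt hxy)
  have : ∀ j : ℕ, ∑ q : Finset.HasAntidiagonal.antidiagonal j,
      (dterm lam x y ∘ Finset.HasAntidiagonal.sigmaAntidiagonalEquivProd) ⟨j, q⟩ =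
      (pcoef lam j : ℂ) * (x + y) ^ j := by
    intro j
    rw [← dterm_antidiag]
    exact Finset.sum_coe_sort (Finset.HasAntidiagonal.antidiagonal j) (dterm lam x y)
  simp_rw [this] at h2
  rw [← h3.unique h2] at h1
  rwa [Finset.HasAntidiagonal.sigmaAntidiagonalEquivProd.hasSum_iff] at h1

lemma gen_small {lam : ℝ} (h : 0 < lam) (t : ℝ) (ht : |t| ≤ 1) (z : ℂ) (hz : ‖z‖ < 1 / 4) :
    HasSum (fun l : ℕ => (gegenbauer lam l t : ℂ) * z ^ l)
      (1 / (1 - 2 * t * z + z ^ 2) ^ (lam : ℂ)) := by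
  have h1 := dterm_hasSum h (-z ^ 2) (2 * t * z) (by
    simp only [norm_neg, norm_pow, norm_mul, Complex.norm_real, Real.norm_eq_abs]
    have := norm_nonneg z
    have : ‖(2 : ℂ)‖ = 2 := by simp
    rw [this]
    nlinarith [abs_nonneg t, mul_le_mul_of_nonneg_right ht (norm_nonneg z)])
  have he : (1 : ℂ) - (-z ^ 2 + 2 * t * z) = 1 - 2 * t * z + z ^ 2 := by ring
  rw [he] at h1
  let e : ℕ × ℕ → ℕ × ℕ := fun q => (2 * q.1 + q.2, q.1)
  have hinj : Function.Injective e := by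
    rintro ⟨a, b⟩ ⟨c, d⟩ hh
    simp only [e, Prod.mk.injEq] at hh ⊢
    omega
  let H : ℕ × ℕ → ℂ := fun q => if 2 * q.2 ≤ q.1 then
    dterm lam (-z ^ 2) (2 * t * z) (q.2, q.1 - 2 * q.2) else 0
  have hH : HasSum H (1 / (1 - 2 * t * z + z ^ 2) ^ (lam : ℂ)) := by
    rw [← hinj.hasSum_iff]
    · convert h1 using 1
      funext ⟨a, b⟩
      simp [H, e]
    · rintro ⟨l, k⟩ hlk
      simp only [H]
      rw [if_neg]
      intro hh
      apply hlk
      refine ⟨(k, l - 2 * k), ?_⟩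
      simp only [e, Prod.mk.injEq, and_true]
      omega
  refine hH.prod_fiberwise fun l => ?_
  have h5 : HasSum (fun k => H (l, k)) (∑ k ∈ Finset.range (l / 2 + 1), H (l, k)) := by
    apply hasSum_sum_of_ne_finset_zero
    intro k hk
    simp only [H]
    rw [if_neg]
    intro hh
    apply hk
    rw [Finset.mem_range]
    omega
  convert h5 using 1
  unfold gegenbauer
  push_cast
  rw [Finset.sum_mul]
  refine Finset.sum_congr rfl fun k hk => ?_
  rw [Finset.mem_range] at hk
  have hk2 : 2 * k ≤ l := by omega
  simp only [H, if_pos hk2]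
  obtain ⟨i, rfl⟩ : ∃ i, l = 2 * k + i := ⟨l - 2 * k, by omega⟩
  have e1 : 2 * k + i - 2 * k = i := by omega
  rw [e1]
  unfold dterm pcoef
  have e2 : ((2 * k + i : ℕ) : ℝ) - k + lam = ((k + i : ℕ) : ℝ) + lam := by push_cast; ring
  rw [e2]
  have e3 : ((k + i).choose k : ℂ) = (k + i).factorial / (k.factorial * i.factorial) := by
    have := Nat.add_choose_mul_factorial_mul_factorial k i
    rw [Nat.choose_symm_add.symm] at this
    have hk0 : (k.factorial : ℂ) ≠ 0 := by exact_mod_cast k.factorial_ne_zero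
    have hi0 : (i.factorial : ℂ) ≠ 0 := by exact_mod_cast i.factorial_ne_zero
    rw [eq_div_iff (mul_ne_zero hk0 hi0), ← mul_assoc]
    exact_mod_cast this
  simp only [e3]
  have hk0 : (k.factorial : ℂ) ≠ 0 := by exact_mod_cast k.factorial_ne_zero
  have hi0 : (i.factorial : ℂ) ≠ 0 := by exact_mod_cast i.factorial_ne_zero
  have hki0 : ((k + i).factorial : ℂ) ≠ 0 := by exact_mod_cast (k + i).factorial_ne_zero
  have hg : (Real.Gamma lam : ℂ) ≠ 0 := by exact_mod_cast (Real.Gamma_pos_of_pos h).ne'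
  push_cast
  field_simp
  rw [mul_pow (2 * (t : ℂ)) z i, neg_pow (z ^ 2), pow_add, pow_mul]
  ring

lemma slit (t : ℝ) (ht : |t| ≤ 1) (z : ℂ) (hz : ‖z‖ < 1) :
    1 - 2 * t * z + z ^ 2 ∈ Complex.slitPlane := by
  have h1 : z.re ^ 2 + z.im ^ 2 < 1 := by
    have := Complex.sq_norm z
    rw [Complex.normSq_apply] at this
    nlinarith [norm_nonneg z]
  obtain ⟨ht1, ht2⟩ := abs_le.mp ht
  rw [Complex.mem_slitPlane_iff]
  have hre : (1 - 2 * t * z + z ^ 2).re = 1 - 2 * t * z.re + (z.re ^ 2 - z.im ^ 2) := by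
    simp [pow_two]
  have him : (1 - 2 * t * z + z ^ 2).im = 2 * z.im * (z.re - t) := by
    simp [pow_two]; ring
  rw [hre, him]
  by_cases hq : z.im = 0
  · left
    rw [hq]
    have : z.re ^ 2 < 1 := by nlinarith
    nlinarith [abs_lt_of_sq_lt_sq (a := z.re) (b := 1) (by linarith) (by norm_num),
      sq_nonneg (z.re - t), mul_nonneg (by linarith : 0 ≤ 1 - t) (by linarith : 0 ≤ 1 + t)]
  · by_cases hp : z.re = t
    · left; subst hp; nlinarith
    · right
      exact mul_ne_zero (mul_ne_zero two_ne_zero hq) (sub_ne_zero.mpr hp)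

lemma gen_complex {lam : ℝ} (h : 0 < lam) (t : ℝ) (ht : |t| ≤ 1) (z : ℂ) (hz : ‖z‖ < 1) :
    HasSum (fun l : ℕ => (gegenbauer lam l t : ℂ) * z ^ l)
      (1 / (1 - 2 * t * z + z ^ 2) ^ (lam : ℂ)) := by
  set F : ℂ → ℂ := fun z => 1 / (1 - 2 * t * z + z ^ 2) ^ (lam : ℂ) with hF
  have hd : DifferentiableOn ℂ F (Metric.ball 0 1) := by
    intro w hw
    have hw1 : ‖w‖ < 1 := by simpa using hw
    have hs := slit t ht w hw1
    apply DifferentiableAt.differentiableWithinAt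
    apply DifferentiableAt.div (differentiableAt_const _)
    · exact DifferentiableAt.cpow_const (by fun_prop) hs
    · rw [Ne, Complex.cpow_eq_zero_iff]
      exact fun hh => Complex.slitPlane_ne_zero hs hh.1
  have hT := Complex.hasSum_taylorSeries_on_ball hd (z := z) (by simpa using hz)
  -- power series at zero
  set p := FormalMultilinearSeries.ofScalars ℂ (fun l : ℕ => (gegenbauer lam l t : ℂ)) with hp
  have h1 : HasFPowerSeriesAt F p 0 := by
    rw [hasFPowerSeriesAt_iff]
    filter_upwards [Metric.ball_mem_nhds (0 : ℂ) (by norm_num : (0 : ℝ) < 1 / 4)] with w hw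
    have := gen_small h t ht w (by simpa using hw)
    simpa [hp, hF, FormalMultilinearSeries.coeff_ofScalars, mul_comm] using this
  have h2 := (hd.analyticAt (Metric.ball_mem_nhds (0 : ℂ) one_pos)).hasFPowerSeriesAt
  have h3 := h1.eq_formalMultilinearSeries h2
  have h4 : ∀ l : ℕ, (gegenbauer lam l t : ℂ) = iteratedDeriv l F 0 / l.factorial := by
    intro l
    have := FormalMultilinearSeries.ofScalars_series_injective ℂ ℂ h3
    exact congrFun this l
  have h5 : (fun l : ℕ => (gegenbauer lam l t : ℂ) * z ^ l) =
      fun n : ℕ => (n.factorial : ℂ)⁻¹ • (z - 0) ^ n • iteratedDeriv n F 0 := by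
    funext l
    rw [h4]
    simp only [smul_eq_mul, sub_zero]
    field_simp
  rw [h5]
  exact hT

lemma gen_real {lam : ℝ} (h : 0 < lam) (t : ℝ) (ht : |t| ≤ 1) (r : ℝ) (hr : |r| < 1) :
    HasSum (fun l : ℕ => gegenbauer lam l t * r ^ l)
      ((1 - 2 * r * t + r ^ 2) ^ (-lam)) := by
  have h1 := gen_complex h t ht (r : ℂ) (by simpa using hr)
  have hpos : 0 < 1 - 2 * r * t + r ^ 2 := by
    obtain ⟨ht1, ht2⟩ := abs_le.mp ht
    obtain ⟨hr1, hr2⟩ := abs_lt.mp hr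
    nlinarith [sq_nonneg (r - t), mul_nonneg (by linarith : 0 ≤ 1 - t) (by linarith : 0 ≤ 1 + t),
      mul_pos (by linarith : 0 < 1 - r) (by linarith : 0 < 1 + r)]
  have e : (1 / (1 - 2 * t * r + r ^ 2 : ℂ) ^ (lam : ℂ)) =
      (((1 - 2 * r * t + r ^ 2) ^ (-lam) : ℝ) : ℂ) := by
    rw [Complex.ofReal_cpow hpos.le]
    push_cast
    rw [Complex.cpow_neg, one_div]
    congr 3
    ring
  rw [e] at h1
  exact_mod_cast h1

lemma theta_series (c : ℕ → ℝ) (f : ℝ → ℝ)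
    (hf : ∀ r, |r| < 1 → HasSum (fun l : ℕ => c l * r ^ l) (f r)) (r d : ℝ) (hr : |r| < 1)
    (hd : HasDerivAt f d r) : HasSum (fun l : ℕ => (l * c l) * r ^ l) (r * d) := by
  obtain ⟨ρ₁, h1, h2⟩ := exists_between hr
  obtain ⟨ρ, h3, h4⟩ := exists_between h2
  have hρ₁ : 0 < ρ₁ := (abs_nonneg r).trans_lt h1
  have hρ : 0 < ρ := hρ₁.trans h3
  have hs := (hf ρ (by rw [abs_of_pos hρ]; exact h4)).summable
  obtain ⟨M, hM⟩ : ∃ M, ∀ l, |c l * ρ ^ l| ≤ M := by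
    have h' := (hs.tendsto_atTop_zero.norm).bddAbove_range
    obtain ⟨M, hM⟩ := h'
    refine ⟨M, fun l => ?_⟩
    have h2 := hM (Set.mem_range_self l)
    rwa [Real.norm_eq_abs] at h2
  have hq : ρ₁ / ρ < 1 := (div_lt_one hρ).mpr h3
  have hq0 : 0 < ρ₁ / ρ := by positivity
  have hu : Summable (fun l : ℕ => M / ρ₁ * ((l : ℝ) ^ 1 * (ρ₁ / ρ) ^ l)) :=
    (summable_pow_mul_geometric_of_norm_lt_one (R := ℝ) 1 (r := ρ₁ / ρ) (by
      rw [Real.norm_of_nonneg hq0.le]; exact hq)).mul_left (M / ρ₁)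
  have hb : ∀ (l : ℕ) (y : ℝ), y ∈ Metric.ball (0 : ℝ) ρ₁ →
      ‖c l * (l * y ^ (l - 1))‖ ≤ M / ρ₁ * ((l : ℝ) ^ 1 * (ρ₁ / ρ) ^ l) := by
    intro l y hy
    have hy1 : |y| < ρ₁ := by simpa using hy
    rcases l with _ | l
    · simp
    · rw [Real.norm_eq_abs, abs_mul, abs_mul, abs_pow, Nat.add_sub_cancel, pow_one]
      have hM' := hM (l + 1)
      rw [abs_mul, abs_of_pos (pow_pos hρ (l + 1))] at hM'
      have e1 : |((l + 1 : ℕ) : ℝ)| = ((l + 1 : ℕ) : ℝ) := abs_of_nonneg (by positivity)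
      rw [e1]
      have e2 : M / ρ₁ * (((l + 1 : ℕ) : ℝ) * (ρ₁ / ρ) ^ (l + 1)) =
          (M / ρ ^ (l + 1)) * (((l + 1 : ℕ) : ℝ) * ρ₁ ^ l) := by
        rw [div_pow, pow_succ ρ₁ l]; field_simp
      rw [e2]
      have e3 : |c (l + 1)| ≤ M / ρ ^ (l + 1) := by
        rw [le_div_iff₀ (by positivity)]; exact hM'
      have e4 : |y| ^ l ≤ ρ₁ ^ l := pow_le_pow_left₀ (abs_nonneg _) hy1.le l
      exact mul_le_mul e3 (by gcongr) (by positivity) ((abs_nonneg _).trans e3)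
  have hrb : r ∈ Metric.ball (0 : ℝ) ρ₁ := by simpa using h1
  have hD := hasDerivAt_tsum_of_isPreconnected (g := fun l y => c l * y ^ l)
    (g' := fun l y => c l * (l * y ^ (l - 1))) hu Metric.isOpen_ball
    (convex_ball (0 : ℝ) ρ₁).isPreconnected
    (fun l y _ => (hasDerivAt_pow l y).const_mul (c l)) hb hrb (hf r hr).summable hrb
  have hD' : HasDerivAt f (∑' l : ℕ, c l * (l * r ^ (l - 1))) r := by
    apply hD.congr_of_eventuallyEq
    filter_upwards [Metric.isOpen_ball.mem_nhds hrb] with y hy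
    have hy1 : |y| < ρ₁ := by simpa using hy
    exact (hf y (hy1.trans h2)).tsum_eq.symm
  rw [hd.unique hD']
  have hS : Summable (fun l : ℕ => c l * (l * r ^ (l - 1))) :=
    Summable.of_norm_bounded hu (fun l => hb l r hrb)
  have e : (fun l : ℕ => (l * c l) * r ^ l) = fun l : ℕ => r * (c l * (l * r ^ (l - 1))) := by
    funext l
    rcases l with _ | l
    · simp
    · simp only [Nat.add_sub_cancel, pow_succ]; ring
  rw [e]
  exact hS.hasSum.mul_left r

noncomputable def DD (t r : ℝ) : ℝ := 1 - 2 * r * t + r ^ 2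

noncomputable def EE (i : ℕ) (s : ℝ) (t r : ℝ) : ℝ := (1 - r ^ 2) ^ i * (DD t r) ^ (-s)

lemma DD_pos {t r : ℝ} (ht : |t| ≤ 1) (hr : |r| < 1) : 0 < DD t r := by
  unfold DD
  obtain ⟨ht1, ht2⟩ := abs_le.mp ht
  obtain ⟨hr1, hr2⟩ := abs_lt.mp hr
  nlinarith [sq_nonneg (r - t), mul_nonneg (by linarith : 0 ≤ 1 - t) (by linarith : 0 ≤ 1 + t),
      mul_pos (by linarith : 0 < 1 - r) (by linarith : 0 < 1 + r)]

/-- `g = r ∂_r f`, with the `r`-derivative bounded near `r = 0`. -/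
def Th (f g : ℝ → ℝ → ℝ) : Prop :=
  ∃ d : ℝ → ℝ → ℝ, (∀ t r, |t| ≤ 1 → |r| < 1 → HasDerivAt (f t) (d t r) r ∧ r * d t r = g t r) ∧
    ∃ C : ℝ, ∀ t r, |t| ≤ 1 → 0 ≤ r → r ≤ 1 / 2 → |d t r| ≤ C

lemma Th.add {f g f' g' : ℝ → ℝ → ℝ} (h : Th f g) (h' : Th f' g') : Th (f + f') (g + g') := by
  obtain ⟨d, hd, C, hC⟩ := h
  obtain ⟨d', hd', C', hC'⟩ := h'
  refine ⟨d + d', fun t r ht hr => ⟨(hd t r ht hr).1.add (hd' t r ht hr).1, ?_⟩, C + C', ?_⟩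
  · have := (hd t r ht hr).2
    have := (hd' t r ht hr).2
    simp only [Pi.add_apply]
    linarith
  · intro t r ht hr hr'
    exact (abs_add_le _ _).trans (add_le_add (hC t r ht hr hr') (hC' t r ht hr hr'))

lemma Th.smul {f g : ℝ → ℝ → ℝ} (a : ℝ) (h : Th f g) : Th (a • f) (a • g) := by
  obtain ⟨d, hd, C, hC⟩ := h
  refine ⟨a • d, fun t r ht hr => ⟨(hd t r ht hr).1.const_smul a, ?_⟩, |a| * C, ?_⟩
  · have := (hd t r ht hr).2
    simp only [Pi.smul_apply, smul_eq_mul, ← this]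
    ring
  · intro t r ht hr hr'
    simp only [Pi.smul_apply, smul_eq_mul, abs_mul]
    exact mul_le_mul_of_nonneg_left (hC t r ht hr hr') (abs_nonneg _)

lemma Th.zero : Th 0 0 :=
  ⟨0, fun t r _ _ => ⟨hasDerivAt_const _ _, by simp⟩, 0, by simp⟩

lemma Th_EE (i : ℕ) (s : ℝ) :
    Th (EE i s) ((2 * (i : ℝ) - s) • EE i s + (-2 * (i : ℝ)) • EE (i - 1) s + s • EE (i + 1) (s + 1)) := by
  refine ⟨fun t r => (i * (1 - r ^ 2) ^ (i - 1) * (-2 * r)) * (DD t r) ^ (-s) +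
    (1 - r ^ 2) ^ i * ((-2 * t + 2 * r) * (-s) * (DD t r) ^ (-s - 1)), ?_, ?_⟩
  · intro t r ht hr
    have hD := DD_pos ht hr
    constructor
    · have h1 : HasDerivAt (fun r : ℝ => 1 - r ^ 2) (-2 * r) r := by
        have := (hasDerivAt_pow 2 r).const_sub 1
        exact this.congr_deriv (by norm_num)
      have h2 : HasDerivAt (DD t) (-2 * t + 2 * r) r := by
        have := ((((hasDerivAt_id r).const_mul 2).mul_const t).const_sub 1).add
          (hasDerivAt_pow 2 r)
        exact this.congr_deriv (by norm_num)
      exact (h1.pow i).mul (h2.rpow_const (Or.inl hD.ne'))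
    · have e1 : (DD t r) ^ (-s) = (DD t r) * (DD t r) ^ (-s - 1) := by
        have := Real.rpow_add hD 1 (-s - 1)
        rw [Real.rpow_one] at this
        rw [← this]
        congr 1; ring
      have e2 : (DD t r) ^ (-(s + 1)) = (DD t r) ^ (-s - 1) := by congr 1; ring
      simp only [Pi.add_apply, Pi.smul_apply, smul_eq_mul, EE, e2, e1]
      rcases i with _ | i
      · simp only [DD, Nat.cast_zero, pow_zero, zero_add, pow_one]; ring
      · simp only [Nat.add_sub_cancel, DD, pow_succ]; push_cast; ring
  · have hc : ContinuousOn (fun q : ℝ × ℝ =>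
        (i * (1 - q.2 ^ 2) ^ (i - 1) * (-2 * q.2)) * (DD q.1 q.2) ^ (-s) +
    (1 - q.2 ^ 2) ^ i * ((-2 * q.1 + 2 * q.2) * (-s) * (DD q.1 q.2) ^ (-s - 1)))
        (Icc (-1 : ℝ) 1 ×ˢ Icc (0 : ℝ) (1 / 2)) := by
      have hDc : ContinuousOn (fun q : ℝ × ℝ => DD q.1 q.2) (Icc (-1 : ℝ) 1 ×ˢ Icc (0 : ℝ) (1 / 2)) := by
        unfold DD; fun_prop
      have hne : ∀ q ∈ (Icc (-1 : ℝ) 1 ×ˢ Icc (0 : ℝ) (1 / 2)), DD q.1 q.2 ≠ 0 := by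
        rintro ⟨t, r⟩ ⟨ht, hr⟩
        exact (DD_pos (abs_le.mpr ht) (abs_lt.mpr ⟨by linarith [hr.1], by linarith [hr.2]⟩)).ne'
      have r1 := hDc.rpow_const (p := -s) (fun q hq => Or.inl (hne q hq))
      have r2 := hDc.rpow_const (p := -s - 1) (fun q hq => Or.inl (hne q hq))
      refine ContinuousOn.add (ContinuousOn.mul (by fun_prop) r1)
        (ContinuousOn.mul (by fun_prop) (ContinuousOn.mul (by fun_prop) r2))
    obtain ⟨C, hC⟩ := (isCompact_Icc.prod isCompact_Icc).exists_bound_of_continuousOn hc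
    exact ⟨C, fun t r ht hr hr' => hC (t, r) ⟨abs_le.mp ht, hr, hr'⟩⟩

/-- remainder class -/
def RR (s₀ p : ℝ) : Submodule ℝ (ℝ → ℝ → ℝ) :=
  Submodule.span ℝ {f | ∃ (i k : ℕ), 1 ≤ k ∧ 2 * (s₀ + k) - i ≤ p ∧ f = EE i (s₀ + k)}

lemma EE_mem_RR {s₀ p s : ℝ} {i k : ℕ} (hk : 1 ≤ k) (hs : s = s₀ + k) (h : 2 * s - i ≤ p) :
    EE i s ∈ RR s₀ p := by
  subst hs
  exact Submodule.subset_span ⟨i, k, hk, h, rfl⟩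

lemma RR_step {s₀ p : ℝ} {f : ℝ → ℝ → ℝ} (hf : f ∈ RR s₀ p) : ∃ g ∈ RR s₀ (p + 1), Th f g := by
  induction hf using Submodule.span_induction with
  | mem f hf =>
    obtain ⟨i, k, hk, hp, rfl⟩ := hf
    refine ⟨_, ?_, Th_EE i (s₀ + k)⟩
    refine Submodule.add_mem _ (Submodule.add_mem _ ?_ ?_) ?_
    · exact Submodule.smul_mem _ _ (EE_mem_RR hk rfl (by linarith))
    · rcases i with _ | i
      · simp
      · refine Submodule.smul_mem _ _ (EE_mem_RR hk rfl ?_)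
        push_cast at hp
        simp only [Nat.add_sub_cancel]
        linarith
    · refine Submodule.smul_mem _ _ (EE_mem_RR (k := k + 1) (by omega) (by push_cast; ring) ?_)
      push_cast
      linarith
  | zero => exact ⟨0, Submodule.zero_mem _, Th.zero⟩
  | add f f' _ _ h h' =>
    obtain ⟨g, hg, hfg⟩ := h
    obtain ⟨g', hg', hfg'⟩ := h'
    exact ⟨g + g', Submodule.add_mem _ hg hg', hfg.add hfg'⟩
  | smul a f _ h =>
    obtain ⟨g, hg, hfg⟩ := h
    exact ⟨a • g, Submodule.smul_mem _ _ hg, hfg.smul a⟩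

/-- size bound -/
def BB (p : ℝ) (f : ℝ → ℝ → ℝ) : Prop :=
  ∃ C : ℝ, ∀ t r, |t| ≤ 1 → 0 < r → r < 1 → |f t r| ≤ C * (DD t r) ^ (-(p / 2))

lemma BB.add {p : ℝ} {f g : ℝ → ℝ → ℝ} (hf : BB p f) (hg : BB p g) : BB p (f + g) := by
  obtain ⟨C, hC⟩ := hf
  obtain ⟨C', hC'⟩ := hg
  refine ⟨C + C', fun t r ht h0 h1 => ?_⟩
  rw [add_mul]
  exact (abs_add_le _ _).trans (add_le_add (hC t r ht h0 h1) (hC' t r ht h0 h1))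

lemma BB.smul {p : ℝ} {f : ℝ → ℝ → ℝ} (a : ℝ) (hf : BB p f) : BB p (a • f) := by
  obtain ⟨C, hC⟩ := hf
  refine ⟨|a| * C, fun t r ht h0 h1 => ?_⟩
  simp only [Pi.smul_apply, smul_eq_mul, abs_mul, mul_assoc]
  exact mul_le_mul_of_nonneg_left (hC t r ht h0 h1) (abs_nonneg _)

lemma BB_EE {p s : ℝ} {i : ℕ} (h : 2 * s - i ≤ p) : BB p (EE i s) := by
  refine ⟨2 ^ i * 4 ^ ((p + i) / 2 - s), fun t r ht h0 h1 => ?_⟩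
  have hD := DD_pos ht (r := r) (abs_lt.mpr ⟨by linarith, h1⟩)
  obtain ⟨ht1, ht2⟩ := abs_le.mp ht
  have hD4 : DD t r ≤ 4 := by unfold DD; nlinarith
  have hDr : (1 - r) ^ 2 ≤ DD t r := by unfold DD; nlinarith
  have hw0 : 0 ≤ 1 - r ^ 2 := by nlinarith
  have hw : 1 - r ^ 2 ≤ 2 * (DD t r) ^ (1 / 2 : ℝ) := by
    have : 1 - r ≤ (DD t r) ^ (1 / 2 : ℝ) := by
      rw [← Real.sqrt_eq_rpow]
      exact Real.le_sqrt_of_sq_le hDr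
    nlinarith
  have hDs := Real.rpow_nonneg hD.le (-s)
  unfold EE
  rw [abs_of_nonneg (by positivity)]
  calc (1 - r ^ 2) ^ i * DD t r ^ (-s) ≤ (2 * (DD t r) ^ (1 / 2 : ℝ)) ^ i * DD t r ^ (-s) := by
        gcongr
    _ = 2 ^ i * (DD t r) ^ ((p + i) / 2 - s) * (DD t r) ^ (-(p / 2)) := by
        rw [mul_pow, ← Real.rpow_natCast (DD t r ^ (1 / 2 : ℝ)), ← Real.rpow_mul hD.le,
          mul_assoc, mul_assoc, ← Real.rpow_add hD, ← Real.rpow_add hD]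
        congr 2; ring
    _ ≤ _ := by
        have : (DD t r) ^ ((p + i) / 2 - s) ≤ 4 ^ ((p + i) / 2 - s) :=
          Real.rpow_le_rpow hD.le hD4 (by linarith)
        have := Real.rpow_nonneg hD.le (-(p / 2))
        gcongr

lemma BB_RR {s₀ p : ℝ} {f : ℝ → ℝ → ℝ} (hf : f ∈ RR s₀ p) : BB p f := by
  induction hf using Submodule.span_induction with
  | mem f hf =>
    obtain ⟨i, k, hk, hp, rfl⟩ := hf
    exact BB_EE hp
  | zero => exact ⟨0, by simp⟩
  | add f f' _ _ h h' => exact h.add h'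
  | smul a f _ h => exact h.smul a

lemma EE_cont {i : ℕ} {s t : ℝ} (ht : t < 1) : ContinuousAt (EE i s t) 1 := by
  have h2 : ContinuousAt (DD t) 1 := by unfold DD; fun_prop
  have h3 : DD t 1 ≠ 0 := by unfold DD; intro h; linarith
  unfold EE
  exact ContinuousAt.mul (by fun_prop) (h2.rpow_const (Or.inl h3))

lemma RR_one {s₀ p : ℝ} {f : ℝ → ℝ → ℝ} (hf : f ∈ RR s₀ p) :
    (∃ q : Polynomial ℝ, q.coeff 0 = 0 ∧ ∀ t < 1,
      f t 1 = (2 - 2 * t) ^ (-s₀) * q.eval (2 - 2 * t)⁻¹) ∧ ∀ t < 1, ContinuousAt (f t) 1 := by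
  induction hf using Submodule.span_induction with
  | mem f hf =>
    obtain ⟨i, k, hk, hp, rfl⟩ := hf
    refine ⟨⟨Polynomial.C (0 ^ i) * Polynomial.X ^ k, ?_, ?_⟩, fun t ht => EE_cont ht⟩
    · rw [Polynomial.coeff_C_mul, Polynomial.coeff_X_pow, if_neg (by omega), mul_zero]
    · intro t ht
      have e : DD t 1 = 2 - 2 * t := by unfold DD; ring
      have hpos : 0 < 2 - 2 * t := by linarith
      rw [EE, e, neg_add, Real.rpow_add hpos, Real.rpow_neg hpos.le (k : ℝ), Real.rpow_natCast]
      simp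
      ring
  | zero => exact ⟨⟨0, by simp⟩, fun t _ => continuousAt_const⟩
  | add f f' _ _ h h' =>
    obtain ⟨⟨q, hq, hq'⟩, hc⟩ := h
    obtain ⟨⟨u, hu, hu'⟩, hc'⟩ := h'
    refine ⟨⟨q + u, by simp [hq, hu], fun t ht => ?_⟩, fun t ht => (hc t ht).add (hc' t ht)⟩
    simp only [Pi.add_apply, hq' t ht, hu' t ht, Polynomial.eval_add]
    ring
  | smul a f _ h =>
    obtain ⟨⟨q, hq, hq'⟩, hc⟩ := h
    refine ⟨⟨a • q, by simp [hq], fun t ht => ?_⟩, fun t ht => (hc t ht).const_smul a⟩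
    simp only [Pi.smul_apply, smul_eq_mul, hq' t ht, Polynomial.eval_smul]
    ring

lemma Th.series {f g : ℝ → ℝ → ℝ} (h : Th f g) {c : ℝ → ℕ → ℝ}
    (hf : ∀ t r, |t| ≤ 1 → |r| < 1 → HasSum (fun l : ℕ => c t l * r ^ l) (f t r)) :
    ∀ t r, |t| ≤ 1 → |r| < 1 → HasSum (fun l : ℕ => (l * c t l) * r ^ l) (g t r) := by
  intro t r ht hr
  obtain ⟨d, hd, -⟩ := h
  obtain ⟨h1, h2⟩ := hd t r ht hr
  rw [← h2]
  exact theta_series (c t) (f t) (fun r hr => hf t r ht hr) r _ hr h1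

lemma Th.bound {f g : ℝ → ℝ → ℝ} (h : Th f g) :
    ∃ C : ℝ, ∀ t r, |t| ≤ 1 → 0 ≤ r → r ≤ 1 / 2 → |g t r| ≤ C * r := by
  obtain ⟨d, hd, C, hC⟩ := h
  refine ⟨C, fun t r ht h0 h1 => ?_⟩
  rw [← (hd t r ht (abs_lt.mpr ⟨by linarith, by linarith⟩)).2, abs_mul, abs_of_nonneg h0, mul_comm]
  exact mul_le_mul_of_nonneg_right (hC t r ht h0 h1) h0

/-- The `m`-th derivative of the Poisson kernel, up to a remainder. -/
noncomputable def FF (lam : ℝ) (m : ℕ) (ρ : ℝ → ℝ → ℝ) : ℝ → ℝ → ℝ :=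
  ((1 - lam) ^ m) • EE 1 (lam + 1) + ((-(lam + 1)) ^ m - (1 - lam) ^ m) • EE 0 (lam + 1) + ρ

lemma main_zero {lam : ℝ} (h : 0 < lam) (t r : ℝ) (ht : |t| ≤ 1) (hr : |r| < 1) :
    HasSum (fun l : ℕ => ((lam + l) / lam * gegenbauer lam l t) * r ^ l)
      (EE 1 (lam + 1) t r) := by
  have h0 : ∀ t r, |t| ≤ 1 → |r| < 1 →
      HasSum (fun l : ℕ => gegenbauer lam l t * r ^ l) (EE 0 lam t r) := by
    intro t r ht hr
    simpa [EE, DD] using gen_real h t ht r hr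
  have h1 := (Th_EE 0 lam).series h0 t r ht hr
  have h2 := (h0 t r ht hr).add (h1.mul_left lam⁻¹)
  have e1 : EE 1 (lam + 1) t r = EE 0 lam t r + lam⁻¹ * (((2 * ((0 : ℕ) : ℝ) - lam) • EE 0 lam +
      (-2 * ((0 : ℕ) : ℝ)) • EE (0 - 1) lam + lam • EE (0 + 1) (lam + 1)) t r) := by
    simp only [Pi.add_apply, Pi.smul_apply, smul_eq_mul]
    push_cast
    field_simp
    ring
  rw [e1]
  have e2 : (fun l : ℕ => ((lam + l) / lam * gegenbauer lam l t) * r ^ l) =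
      fun l : ℕ => gegenbauer lam l t * r ^ l + lam⁻¹ * ((l * gegenbauer lam l t) * r ^ l) := by
    funext l
    field_simp
  rw [e2]
  exact h2

lemma main_series {lam N : ℝ} (h : 0 < lam) (hN : N = 2 * lam + 1) (m : ℕ) :
    ∃ ρ ∈ RR (lam + 1) (N + m),
      (∀ t r, |t| ≤ 1 → |r| < 1 →
        HasSum (fun l : ℕ => ((l : ℝ) ^ m * ((lam + l) / lam * gegenbauer lam l t)) * r ^ l)
        (FF lam m ρ t r)) ∧
      (1 ≤ m → ∃ C : ℝ, ∀ t r, |t| ≤ 1 → 0 ≤ r → r ≤ 1 / 2 → |FF lam m ρ t r| ≤ C * r) := by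
  induction m with
  | zero =>
    refine ⟨0, Submodule.zero_mem _, fun t r ht hr => ?_, by simp⟩
    simpa [FF] using main_zero h t r ht hr
  | succ m ih =>
    obtain ⟨ρ, hρ, hs, -⟩ := ih
    obtain ⟨ρ', hρ', hT⟩ := RR_step hρ
    have T1 := (Th_EE 1 (lam + 1)).smul ((1 - lam) ^ m)
    have T0 := (Th_EE 0 (lam + 1)).smul ((-(lam + 1)) ^ m - (1 - lam) ^ m)
    have T := (T1.add T0).add hT
    set ρ₂ : ℝ → ℝ → ℝ := ((1 - lam) ^ m * (lam + 1)) • EE 2 (lam + 1 + 1) +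
      (((-(lam + 1)) ^ m - (1 - lam) ^ m) * (lam + 1)) • EE 1 (lam + 1 + 1) + ρ' with hρ₂
    have hT2 : Th (FF lam m ρ) (FF lam (m + 1) ρ₂) := by
      have e : FF lam (m + 1) ρ₂ = (1 - lam) ^ m •
            ((2 * ((1 : ℕ) : ℝ) - (lam + 1)) • EE 1 (lam + 1) +
              (-2 * ((1 : ℕ) : ℝ)) • EE (1 - 1) (lam + 1) +
              (lam + 1) • EE (1 + 1) (lam + 1 + 1)) +
          ((-(lam + 1)) ^ m - (1 - lam) ^ m) •
            ((2 * ((0 : ℕ) : ℝ) - (lam + 1)) • EE 0 (lam + 1) +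
              (-2 * ((0 : ℕ) : ℝ)) • EE (0 - 1) (lam + 1) +
              (lam + 1) • EE (0 + 1) (lam + 1 + 1)) + ρ' := by
        funext t r
        simp only [FF, hρ₂, Pi.add_apply, Pi.smul_apply, smul_eq_mul, pow_succ]
        push_cast
        norm_num
        ring
      rw [e]
      exact T
    refine ⟨ρ₂, ?_, ?_, fun _ => hT2.bound⟩
    · refine Submodule.add_mem _ (Submodule.add_mem _ ?_ ?_) ?_
      · refine Submodule.smul_mem _ _ (EE_mem_RR (k := 1) le_rfl (by norm_num) ?_)
        push_cast
        have : (0 : ℝ) ≤ m := by positivity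
        linarith
      · rcases m with _ | m
        · simp
        · refine Submodule.smul_mem _ _ (EE_mem_RR (k := 1) le_rfl (by norm_num) ?_)
          push_cast
          have : (0 : ℝ) ≤ m := by positivity
          linarith
      · have e : N + ((m + 1 : ℕ) : ℝ) = N + m + 1 := by push_cast; ring
        rw [e]
        exact hρ'
    · intro t r ht hr
      have := hT2.series (c := fun t l => (l : ℝ) ^ m * ((lam + l) / lam * gegenbauer lam l t))
        hs t r ht hr
      convert this using 3 with l
      ring

lemma FF_BB {lam N : ℝ} (hN : N = 2 * lam + 1) {m : ℕ} (hm : 1 ≤ m) {ρ : ℝ → ℝ → ℝ}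
    (hρ : ρ ∈ RR (lam + 1) (N + m)) : BB (N + m) (FF lam m ρ) := by
  have : (1 : ℝ) ≤ m := by exact_mod_cast hm
  exact (((BB_EE (by push_cast; linarith)).smul _).add
    ((BB_EE (by push_cast; linarith)).smul _)).add (BB_RR hρ)

lemma FF_bound {lam : ℝ} {n m : ℕ} (hN : (n : ℝ) = 2 * lam + 1) (hm : 1 ≤ m) {ρ : ℝ → ℝ → ℝ}
    (hρ : ρ ∈ RR (lam + 1) (n + m))
    (hsm : ∃ C : ℝ, ∀ t r, |t| ≤ 1 → 0 ≤ r → r ≤ 1 / 2 → |FF lam m ρ t r| ≤ C * r) :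
    ∃ C : ℝ, 0 ≤ C ∧ ∀ x r : ℝ, 0 < x → x ≤ π → 0 < r → r < 1 →
      |FF lam m ρ (Real.cos x) r| ≤ C * r / x ^ (m + n) := by
  obtain ⟨C₁, hC₁⟩ := FF_BB hN hm hρ
  obtain ⟨C₂, hC₂⟩ := hsm
  refine ⟨(2 * |C₁| + |C₂|) * π ^ (m + n), by positivity, fun x r hx hxπ hr hr1 => ?_⟩
  have ht : |Real.cos x| ≤ 1 := Real.abs_cos_le_one x
  have hpx : 1 ≤ π ^ (m + n) / x ^ (m + n) := by
    rw [one_le_div (by positivity)]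
    exact pow_le_pow_left₀ hx.le hxπ _
  have e : (2 * |C₁| + |C₂|) * π ^ (m + n) * r / x ^ (m + n) =
      (2 * |C₁| + |C₂|) * r * (π ^ (m + n) / x ^ (m + n)) := by ring
  rw [e]
  rcases le_total r (1 / 2) with h | h
  · refine (hC₂ _ r ht hr.le h).trans ?_
    calc C₂ * r ≤ |C₂| * r := by gcongr; exact le_abs_self _
      _ ≤ (2 * |C₁| + |C₂|) * r := by gcongr; linarith [abs_nonneg C₁]
      _ ≤ _ := le_mul_of_one_le_right (by positivity) hpx
  · refine (hC₁ _ r ht hr hr1).trans ?_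
    have hDD : (x / π) ^ 2 ≤ DD (Real.cos x) r := by
      have h1 : x / π ≤ Real.sin (x / 2) := by
        have := Real.mul_le_sin (x := x / 2) (by linarith) (by linarith)
        calc x / π = 2 / π * (x / 2) := by ring
          _ ≤ _ := this
      have h2 : Real.cos x = 1 - 2 * Real.sin (x / 2) ^ 2 := by
        have := Real.cos_two_mul (x / 2)
        rw [mul_div_cancel₀ x two_ne_zero] at this
        rw [this, Real.cos_sq']; ring
      have h3 : (x / π) ^ 2 ≤ Real.sin (x / 2) ^ 2 :=
        pow_le_pow_left₀ (by positivity) h1 2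
      have h4 : Real.sin (x / 2) ^ 2 ≤ 1 := Real.sin_sq_le_one _
      unfold DD
      rw [h2]
      nlinarith [mul_nonneg (sq_nonneg (1 - r)) (by linarith : 0 ≤ 1 - Real.sin (x / 2) ^ 2),
        mul_nonneg hr.le (sq_nonneg (Real.sin (x / 2))),
        mul_nonneg (sq_nonneg r) (sq_nonneg (Real.sin (x / 2)))]
    have hxp : 0 < x / π := by positivity
    have hpow : DD (Real.cos x) r ^ (-((n + m : ℝ) / 2)) ≤ π ^ (m + n) / x ^ (m + n) := by
      calc DD (Real.cos x) r ^ (-((n + m : ℝ) / 2)) ≤ ((x / π) ^ 2) ^ (-((n + m : ℝ) / 2)) :=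
            Real.rpow_le_rpow_of_nonpos (by positivity) hDD
              (by have : (0 : ℝ) ≤ (n + m : ℝ) / 2 := by positivity
                  linarith)
        _ = π ^ (m + n) / x ^ (m + n) := by
            rw [← Real.rpow_natCast (x / π) 2, ← Real.rpow_mul hxp.le]
            have : ((2 : ℕ) : ℝ) * (-((n + m : ℝ) / 2)) = -((m + n : ℕ) : ℝ) := by
              push_cast; ring
            rw [this, Real.rpow_neg hxp.le, Real.rpow_natCast, div_pow, inv_div]
    have hq : 0 ≤ π ^ (m + n) / x ^ (m + n) := by positivity
    have hp0 : 0 ≤ DD (Real.cos x) r ^ (-((n + m : ℝ) / 2)) :=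
      Real.rpow_nonneg ((sq_nonneg _).trans hDD) _
    calc C₁ * DD (Real.cos x) r ^ (-((n + m : ℝ) / 2))
        ≤ |C₁| * DD (Real.cos x) r ^ (-((n + m : ℝ) / 2)) := by gcongr; exact le_abs_self _
      _ ≤ |C₁| * (π ^ (m + n) / x ^ (m + n)) := by gcongr
      _ ≤ (2 * |C₁| + |C₂|) * r * (π ^ (m + n) / x ^ (m + n)) := by
          gcongr
          nlinarith [abs_nonneg C₁, abs_nonneg C₂, mul_nonneg (abs_nonneg C₂) hr.le]

lemma FF_one {lam p : ℝ} (h : 0 < lam) {m : ℕ} (hm : 1 ≤ m) {ρ : ℝ → ℝ → ℝ}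
    (hρ : ρ ∈ RR (lam + 1) p) : ∃ t, -1 ≤ t ∧ t < 1 ∧ FF lam m ρ t 1 ≠ 0 := by
  by_contra! hcon
  obtain ⟨⟨q, hq0, hq⟩, -⟩ := RR_one hρ
  set β := (-(lam + 1)) ^ m - (1 - lam) ^ m with hβ
  have hβ0 : β ≠ 0 := by
    intro h0
    have h1 : (-(lam + 1)) ^ m = (1 - lam) ^ m := by linarith
    have h2 := congrArg abs h1
    rw [abs_pow, abs_pow, abs_neg, abs_of_pos (by linarith : 0 < lam + 1)] at h2
    have h3 : |1 - lam| < lam + 1 := abs_lt.mpr ⟨by linarith, by linarith⟩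
    have := pow_lt_pow_left₀ h3 (abs_nonneg _) (by omega : m ≠ 0)
    linarith
  have hz : ∀ v : ℝ, 1 / 4 ≤ v → (Polynomial.C β + q).eval v = 0 := by
    intro v hv
    have hv0 : 0 < v := by linarith
    set t := 1 - 1 / (2 * v) with ht
    have e : 2 - 2 * t = v⁻¹ := by rw [ht]; field_simp; ring
    have hvi : 0 < v⁻¹ := by positivity
    have hv4 : v⁻¹ ≤ 4 := by
      rw [inv_le_comm₀ hv0 (by norm_num)]; linarith
    have h1 := hcon t (by linarith) (by linarith)
    have e2 : DD t 1 = v⁻¹ := by rw [← e, DD]; ring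
    simp only [FF, Pi.add_apply, Pi.smul_apply, smul_eq_mul, ← hβ, hq t (by linarith), EE, e2, e,
      inv_inv] at h1
    have h2 : 0 < (v⁻¹) ^ (-(lam + 1)) := Real.rpow_pos_of_pos hvi _
    have h3 : (v⁻¹) ^ (-(lam + 1)) * (β + q.eval v) = 0 := by
      rw [← h1]; ring
    rw [Polynomial.eval_add, Polynomial.eval_C]
    exact (mul_eq_zero.mp h3).resolve_left h2.ne'
  have hzero : Polynomial.C β + q = 0 := by
    apply Polynomial.eq_zero_of_infinite_isRoot
    exact (Set.Ici_infinite (1 / 4 : ℝ)).mono fun v hv => hz v hv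
  have := congrArg (fun w : Polynomial ℝ => w.coeff 0) hzero
  simp [hq0] at this
  exact hβ0 this

lemma FF_cont {lam p : ℝ} {m : ℕ} {ρ : ℝ → ℝ → ℝ} (hρ : ρ ∈ RR (lam + 1) p) {t : ℝ} (ht : t < 1) :
    ContinuousAt (FF lam m ρ t) 1 := by
  have e : FF lam m ρ t = ((1 - lam) ^ m) • EE 1 (lam + 1) t +
      ((-(lam + 1)) ^ m - (1 - lam) ^ m) • EE 0 (lam + 1) t + ρ t := rfl
  rw [e]
  exact (((EE_cont ht).const_smul _).add ((EE_cont ht).const_smul _)).add ((RR_one hρ).2 t ht)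

lemma sigmaN_pos {n : ℕ} (hn : 2 ≤ n) : 0 < sigmaN n := by
  have h : 0 < lamb n := by
    unfold lamb
    have : (2 : ℝ) ≤ n := by exact_mod_cast hn
    linarith
  unfold sigmaN
  have := Real.Gamma_pos_of_pos (by linarith : 0 < lamb n + 1)
  positivity

lemma pw_eq {n m : ℕ} {ρ : ℝ → ℝ → ℝ}
    (hs : ∀ t r, |t| ≤ 1 → |r| < 1 →
        HasSum (fun l : ℕ => ((l : ℝ) ^ m * ((lamb n + l) / lamb n * gegenbauer (lamb n) l t)) * r ^ l)
        (FF (lamb n) m ρ t r)) (a t : ℝ) (ha : 0 < a) (ht : |t| ≤ 1) :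
    pw n a m t = (1 / sigmaN n) * (a ^ m * FF (lamb n) m ρ t (Real.exp (-a))) := by
  unfold pw
  congr 1
  have hr : |Real.exp (-a)| < 1 := by
    rw [abs_of_pos (Real.exp_pos _), Real.exp_lt_one_iff]; linarith
  have h1 := (hs t _ ht hr).mul_left (a ^ m)
  rw [← h1.tsum_eq]
  congr 1
  funext l
  rw [← Real.exp_nat_mul, mul_pow]
  have : (l : ℝ) * -a = -(a * l) := by ring
  rw [this]
  ring

/-- `|a^n g_a^m(cos(aθ))| ≤ c e^{-a}/θ^{m+n}` uniformly in `a > 0`,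
`θ ∈ (0,π/a]`, and `m+n` is the largest possible exponent. -/
theorem stmt10 (n m : ℕ) (hn : 2 ≤ n) (hm : 1 ≤ m) :
    (∃ c : ℝ, ∀ a : ℝ, 0 < a → ∀ θ ∈ Ioc (0 : ℝ) (π / a),
      |a ^ n * pw n a m (Real.cos (a * θ))| ≤ c * Real.exp (-a) / θ ^ (m + n)) ∧
    (∀ κ : ℝ, ((m : ℝ) + n) < κ →
      ¬ ∃ c : ℝ, ∀ a : ℝ, 0 < a → ∀ θ ∈ Ioc (0 : ℝ) (π / a),
        |a ^ n * pw n a m (Real.cos (a * θ))| ≤ c * Real.exp (-a) / θ ^ κ) := by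
  have hlam : 0 < lamb n := by
    unfold lamb
    have : (2 : ℝ) ≤ n := by exact_mod_cast hn
    linarith
  have hN : (n : ℝ) = 2 * lamb n + 1 := by unfold lamb; ring
  obtain ⟨ρ, hρ, hs, hsm⟩ := main_series hlam hN m
  have hσ := sigmaN_pos hn
  constructor
  · obtain ⟨C, hC0, hC⟩ := FF_bound hN hm hρ (hsm hm)
    refine ⟨1 / sigmaN n * C, fun a ha θ hθ => ?_⟩
    obtain ⟨hθ0, hθ1⟩ := hθ
    have hx0 : 0 < a * θ := by positivity
    have hx1 : a * θ ≤ π := by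
      rw [le_div_iff₀ ha] at hθ1; linarith
    rw [pw_eq hs a _ ha (Real.abs_cos_le_one _)]
    have hr1 : Real.exp (-a) < 1 := by rw [Real.exp_lt_one_iff]; linarith
    have h1 := hC (a * θ) (Real.exp (-a)) hx0 hx1 (Real.exp_pos _) hr1
    rw [abs_mul, abs_mul, abs_mul, abs_of_pos (pow_pos ha n), abs_of_pos (pow_pos ha m),
      abs_of_pos (by positivity : 0 < 1 / sigmaN n)]
    calc a ^ n * (1 / sigmaN n * (a ^ m * |FF (lamb n) m ρ (Real.cos (a * θ)) (Real.exp (-a))|))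
        ≤ a ^ n * (1 / sigmaN n * (a ^ m * (C * Real.exp (-a) / (a * θ) ^ (m + n)))) := by
          gcongr
      _ = 1 / sigmaN n * C * Real.exp (-a) / θ ^ (m + n) := by
          rw [mul_pow, pow_add a m n]
          field_simp
  · rintro κ hκ ⟨c, hc⟩
    obtain ⟨t, ht0, ht1, hne⟩ := FF_one hlam hm hρ
    apply hne
    set x := Real.arccos t with hx
    have hxt : Real.cos x = t := Real.cos_arccos ht0 ht1.le
    have hx0 : 0 < x := Real.arccos_pos.mpr ht1
    have hxπ : x ≤ π := Real.arccos_le_pi t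
    have ht : |t| ≤ 1 := abs_le.mpr ⟨ht0, ht1.le⟩
    have hb : ∀ a : ℝ, 0 < a → |FF (lamb n) m ρ t (Real.exp (-a))| ≤
        sigmaN n * |c| / x ^ κ * a ^ (κ - (m + n)) := by
      intro a ha
      have h1 := hc a ha (x / a) ⟨by positivity, by gcongr⟩
      rw [mul_div_cancel₀ x ha.ne', hxt, pw_eq hs a _ ha ht, abs_mul, abs_mul, abs_mul,
        abs_of_pos (pow_pos ha n), abs_of_pos (pow_pos ha m),
        abs_of_pos (by positivity : 0 < 1 / sigmaN n), Real.div_rpow hx0.le ha.le] at h1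
      have hxk : 0 < x ^ κ := Real.rpow_pos_of_pos hx0 _
      have hak : 0 < a ^ κ := Real.rpow_pos_of_pos ha _
      have h2 : c * Real.exp (-a) / (x ^ κ / a ^ κ) ≤ |c| * 1 / (x ^ κ / a ^ κ) := by
        have : Real.exp (-a) ≤ 1 := by rw [Real.exp_le_one_iff]; linarith
        have := Real.exp_pos (-a)
        gcongr
        exact le_abs_self c
      have h3 := h1.trans h2
      have e : a ^ (κ - (m + n)) = a ^ κ / (a ^ m * a ^ n) := by
        rw [Real.rpow_sub ha, Real.rpow_add ha, Real.rpow_natCast, Real.rpow_natCast]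
      rw [e]
      have han : 0 < a ^ n := pow_pos ha n
      have ham : 0 < a ^ m := pow_pos ha m
      have e3 : sigmaN n * |c| / x ^ κ * (a ^ κ / (a ^ m * a ^ n)) =
          (sigmaN n / (a ^ m * a ^ n)) * (|c| * 1 / (x ^ κ / a ^ κ)) := by
        field_simp
      rw [e3]
      refine le_trans (le_of_eq ?_) (mul_le_mul_of_nonneg_left h3 (by positivity))
      field_simp
    have hl1 : Tendsto (fun a : ℝ => FF (lamb n) m ρ t (Real.exp (-a))) (nhdsWithin 0 (Ioi 0))
        (nhds (FF (lamb n) m ρ t 1)) := by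
      have h1 : Tendsto (fun a : ℝ => Real.exp (-a)) (nhdsWithin 0 (Ioi 0)) (nhds 1) := by
        have : Continuous (fun a : ℝ => Real.exp (-a)) := by fun_prop
        have h := this.tendsto 0
        simp only [neg_zero, Real.exp_zero] at h
        exact h.mono_left nhdsWithin_le_nhds
      exact (FF_cont hρ ht1).tendsto.comp h1
    have hl2 : Tendsto (fun a : ℝ => sigmaN n * |c| / x ^ κ * a ^ (κ - (m + n)))
        (nhdsWithin 0 (Ioi 0)) (nhds 0) := by
      have hpos : 0 < κ - (m + n) := by linarith
      have h1 := (Real.continuousAt_rpow_const 0 (κ - (m + n)) (Or.inr hpos.le)).tendsto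
      rw [Real.zero_rpow hpos.ne'] at h1
      have h0 : nhdsWithin (0 : ℝ) (Ioi 0) ≤ nhds 0 := nhdsWithin_le_nhds
      have h2 := (h1.mono_left h0).const_mul (sigmaN n * |c| / x ^ κ)
      rwa [mul_zero] at h2
    have hl3 := hl1.abs
    have h4 : |FF (lamb n) m ρ t 1| ≤ 0 := by
      refine le_of_tendsto_of_tendsto hl3 hl2 ?_
      filter_upwards [self_mem_nhdsWithin] with a ha
      exact hb a ha
    exact abs_eq_zero.mp (le_antisymm h4 (abs_nonneg _))
end

section
/- Let n ≥ 2 be an integer, λ = (n-1)/2, and m ∈ ℕ. For every t ≥ 0, lim_{a→0⁺} a^n · g_a^m(cos(2 arctan(at/2))) = (1/(Σ_n λ)) · (m+1)! · C_{m+1}^λ(1/√(1+t²)) / (1+t²)^{(m+n)/2}. (Here 2 arctan(at/2) is the polar angle, measured from the north pole ê, of the inverse stereographic projection onto S^n of a point of ℝ^n at distance at from the origin, so this identifies the Euclidean limit g^m of the Poisson wavelets.) -/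
open Real MeasureTheory Set Filter
open scoped RealInnerProductSpace BigOperators

theorem binom_series (lam : ℝ) (hl : 0 < lam) (w : ℂ) (hw : ‖w‖ < 1) :
    HasSum (fun j : ℕ => ((Real.Gamma (j + lam) / (Real.Gamma lam * (Nat.factorial j : ℝ)) : ℝ) : ℂ)
      * w ^ j) ((1 - w) ^ (-(lam : ℂ))) := by
  have h := (Complex.one_div_one_sub_cpow_hasFPowerSeriesOnBall_zero (lam : ℂ)).hasSum
    (y := w) (by
      rw [← ENNReal.ofReal_one, Metric.eball_ofReal]; simpa using hw)
  simp only [zero_add] at h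
  rw [Complex.cpow_neg, ← one_div]
  refine HasSum.congr_fun h (fun j => ?_)
  have h1 : (ascPochhammer ℂ j).eval (lam : ℂ) = Complex.Gamma (lam + j) / Complex.Gamma lam := by
    rw [Complex.Gamma_add_nat_div_Gamma_eq]
    intro k hk
    have := congrArg Complex.re hk
    simp at this
    have : (0:ℝ) ≤ k := Nat.cast_nonneg k
    linarith
  have h2 := Ring.factorial_nsmul_multichoose_eq_ascPochhammer (lam : ℂ) j
  rw [Polynomial.ascPochhammer_smeval_eq_eval, h1, nsmul_eq_mul, Ring.multichoose_eq] at h2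
  have h3 : (Nat.factorial j : ℂ) ≠ 0 := by exact_mod_cast Nat.factorial_ne_zero j
  simp only [FormalMultilinearSeries.ofScalars_apply_eq, smul_eq_mul]
  congr 1
  have h4 : Ring.choose ((lam : ℂ) + j - 1) j
      = (Complex.Gamma (lam + j) / Complex.Gamma lam) / (Nat.factorial j : ℂ) := by
    rw [← h2]; field_simp
  rw [h4]
  push_cast
  rw [← Complex.Gamma_ofReal, ← Complex.Gamma_ofReal]
  push_cast
  rw [div_div, add_comm]

theorem binom_double (lam : ℝ) (hl : 0 < lam) (u v : ℂ) (h : ‖u‖ + ‖v‖ < 1) :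
    HasSum (fun p : ℕ × ℕ =>
      ((Real.Gamma ((p.1 + p.2 : ℕ) + lam) / (Real.Gamma lam * (Nat.factorial (p.1 + p.2) : ℝ)) : ℝ) : ℂ)
      * (Nat.choose (p.1 + p.2) p.1 * u ^ p.1 * v ^ p.2)) ((1 - (u + v)) ^ (-(lam : ℂ))) := by
  set c : ℕ → ℝ := fun j => Real.Gamma (j + lam) / (Real.Gamma lam * (Nat.factorial j : ℝ)) with hc
  have hc0 : ∀ j, 0 ≤ c j := fun j => by
    have := Real.Gamma_pos_of_pos hl
    have := Real.Gamma_pos_of_pos (show 0 < (j : ℝ) + lam by positivity)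
    simp only [hc]; positivity
  set F : ℕ × ℕ → ℂ := fun p => (c (p.1 + p.2) : ℂ)
      * (Nat.choose (p.1 + p.2) p.1 * u ^ p.1 * v ^ p.2) with hF
  change HasSum F _
  have anti : ∀ (x y : ℂ) (j : ℕ), ∑ p ∈ Finset.HasAntidiagonal.antidiagonal j,
      (c (p.1 + p.2) : ℂ) * (Nat.choose (p.1 + p.2) p.1 * x ^ p.1 * y ^ p.2) = c j * (x + y) ^ j := by
    intro x y j
    rw [(Commute.all x y).add_pow', Finset.mul_sum]
    apply Finset.sum_congr rfl
    intro p hp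
    rw [Finset.HasAntidiagonal.mem_antidiagonal] at hp
    rw [hp, nsmul_eq_mul]; ring
  have sn : Summable (fun p => ‖F p‖) := by
    rw [← Finset.HasAntidiagonal.sigmaAntidiagonalEquivProd.summable_iff]
    refine (summable_sigma_of_nonneg (f := (fun p => ‖F p‖) ∘
      Finset.HasAntidiagonal.sigmaAntidiagonalEquivProd) (fun _ => norm_nonneg _)).mpr ⟨fun j => Summable.of_finite, ?_⟩
    have := (binom_series lam hl ((‖u‖ + ‖v‖ : ℝ) : ℂ) (by
      rw [Complex.norm_real, Real.norm_of_nonneg (by positivity)]; exact h)).summable.norm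
    refine this.congr fun j => ?_
    rw [tsum_fintype]
    have e := anti (‖u‖ : ℂ) (‖v‖ : ℂ) j
    have e1 : ∑ b : Finset.HasAntidiagonal.antidiagonal j, ‖F (b : ℕ × ℕ)‖ = c j * (‖u‖ + ‖v‖) ^ j := by
      rw [Finset.sum_coe_sort (Finset.HasAntidiagonal.antidiagonal j) (fun p => ‖F p‖)]
      have e2 : ((∑ p ∈ Finset.HasAntidiagonal.antidiagonal j, ‖F p‖ : ℝ) : ℂ) = ((c j * (‖u‖ + ‖v‖) ^ j : ℝ) : ℂ) := by
        push_cast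
        rw [← e]
        apply Finset.sum_congr rfl
        intro p hp
        simp only [hF, norm_mul, norm_pow, Complex.norm_real, Complex.norm_natCast,
          Real.norm_of_nonneg (hc0 _)]
        push_cast; rfl
      exact_mod_cast e2
    refine Eq.trans ?_ e1.symm
    rw [norm_mul, norm_pow, Complex.norm_real, Complex.norm_real]
    rw [Real.norm_of_nonneg (hc0 j), Real.norm_of_nonneg (show 0 ≤ ‖u‖ + ‖v‖ by positivity)]
  have s : Summable F := sn.of_norm
  have s' : Summable (F ∘ Finset.HasAntidiagonal.sigmaAntidiagonalEquivProd) :=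
    Finset.HasAntidiagonal.sigmaAntidiagonalEquivProd.summable_iff.mpr s
  have t : ∑' p, F p = (1 - (u + v)) ^ (-(lam : ℂ)) := by
    rw [← Finset.HasAntidiagonal.sigmaAntidiagonalEquivProd.tsum_eq F]
    refine (Summable.tsum_sigma' (fun _ => Summable.of_finite) s').trans ?_
    rw [← (binom_series lam hl (u + v) (lt_of_le_of_lt (norm_add_le _ _) h)).tsum_eq]
    congr 1; ext j
    rw [tsum_fintype]
    exact (Finset.sum_coe_sort (Finset.HasAntidiagonal.antidiagonal j) F).trans (anti u v j)
  rw [← t]; exact s.hasSum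

theorem geg_small (lam : ℝ) (hl : 0 < lam) (x : ℝ) (hx : |x| ≤ 1) (r : ℂ) (hr : ‖r‖ < 1 / 4) :
    HasSum (fun l : ℕ => (gegenbauer lam l x : ℂ) * r ^ l)
      ((1 - 2 * r * x + r ^ 2) ^ (-(lam : ℂ))) := by
  have h := binom_double lam hl (2 * r * x) (-r ^ 2) (by
    rw [norm_neg, norm_mul, norm_mul, norm_pow, Complex.norm_real, Real.norm_eq_abs, Complex.norm_ofNat]
    nlinarith [norm_nonneg r, abs_nonneg x])
  have h2 := h.tsum_fiberwise (fun p : ℕ × ℕ => p.1 + 2 * p.2)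
  rw [show (1 : ℂ) - (2 * r * x + -r ^ 2) = 1 - 2 * r * x + r ^ 2 by ring] at h2
  refine HasSum.congr_fun h2 (fun l => ?_)
  have img : ((fun p : ℕ × ℕ => p.1 + 2 * p.2) ⁻¹' {l}) =
      ((Finset.range (l / 2 + 1)).image (fun k => (l - 2 * k, k)) : Finset (ℕ × ℕ)) := by
    ext ⟨p, k⟩
    simp
    omega
  rw [img]
  refine Eq.trans ?_ (Finset.tsum_subtype' _ (fun p : ℕ × ℕ => ((Real.Gamma ((p.1 + p.2 : ℕ) + lam) /
    (Real.Gamma lam * (Nat.factorial (p.1 + p.2) : ℝ)) : ℝ) : ℂ)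
      * (Nat.choose (p.1 + p.2) p.1 * (2 * r * x) ^ p.1 * (-r ^ 2) ^ p.2))).symm
  rw [Finset.sum_image]
  · unfold gegenbauer
    push_cast
    rw [Finset.sum_mul]
    apply Finset.sum_congr rfl
    intro k hk
    have hk' : 2 * k ≤ l := by simp at hk; omega
    obtain ⟨q, rfl⟩ := Nat.exists_eq_add_of_le' hk'
    simp only [Nat.add_sub_cancel]
    have e1 : ((q + 2 * k : ℕ) : ℝ) - k + lam = ((q + k : ℕ) : ℝ) + lam := by push_cast; ring
    push_cast at e1
    push_cast
    rw [e1]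
    have hch : ((Nat.choose (q + k) q : ℕ) : ℂ) = (Nat.factorial (q + k) : ℂ) / (Nat.factorial q * Nat.factorial k) := by
      rw [Nat.cast_add_choose]
    rw [hch]
    have f1 : (Nat.factorial (q + k) : ℂ) ≠ 0 := by exact_mod_cast Nat.factorial_ne_zero _
    have f2 : (Nat.factorial q : ℂ) ≠ 0 := by exact_mod_cast Nat.factorial_ne_zero _
    have f3 : (Nat.factorial k : ℂ) ≠ 0 := by exact_mod_cast Nat.factorial_ne_zero _
    have f4 : (Real.Gamma lam : ℂ) ≠ 0 := by exact_mod_cast (Real.Gamma_pos_of_pos hl).ne'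
    rw [neg_pow (r ^ 2) k, pow_add, pow_mul]
    field_simp
    ring
  · intro a _ b _ hab
    simpa using congrArg Prod.snd hab

theorem coef_of_hasSum (f : ℂ → ℂ) (z₀ : ℂ) (c : ℕ → ℂ)
    (h : ∀ᶠ z in nhds z₀, HasSum (fun n => c n * (z - z₀) ^ n) (f z)) (k : ℕ) :
    iteratedDeriv k f z₀ = Nat.factorial k * c k := by
  have hp : HasFPowerSeriesAt f (FormalMultilinearSeries.ofScalars ℂ c) z₀ := by
    rw [hasFPowerSeriesAt_iff']
    filter_upwards [h] with z hz
    simpa [mul_comm] using hz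
  obtain ⟨r, hr⟩ := hp
  have := hr.factorial_smul (y := 1) k
  rw [iteratedDeriv_eq_iteratedFDeriv]
  rw [← this]
  simp

theorem slit1 (x : ℝ) (hx : |x| ≤ 1) (r : ℂ) (hr : ‖r‖ < 1) :
    1 - 2 * r * x + r ^ 2 ∈ Complex.slitPlane := by
  have hn : r.re ^ 2 + r.im ^ 2 < 1 := by
    have := Complex.sq_norm r
    rw [Complex.normSq_apply] at this
    nlinarith [norm_nonneg r]
  have hx2 := abs_le.mp hx
  rw [Complex.mem_slitPlane_iff]
  by_contra! hcon
  obtain ⟨h1, h2⟩ := hcon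
  simp [pow_two] at h1 h2
  have h3 : r.im * (r.re - x) = 0 := by linarith
  rcases mul_eq_zero.mp h3 with h | h
  · rw [h] at h1 hn
    have : r.re ^ 2 < 1 := by linarith
    have : |r.re| < 1 := by rwa [sq_lt_one_iff_abs_lt_one] at this
    rw [abs_lt] at this
    nlinarith [mul_nonneg (sub_nonneg.2 hx2.2) (sub_nonneg.2 this.1.le), sq_nonneg (r.re - 1), sq_nonneg (r.re + 1)]
  · nlinarith

theorem geg_gen (lam : ℝ) (hl : 0 < lam) (x : ℝ) (hx : |x| ≤ 1) (r : ℂ) (hr : ‖r‖ < 1) :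
    HasSum (fun l : ℕ => (gegenbauer lam l x : ℂ) * r ^ l)
      ((1 - 2 * r * x + r ^ 2) ^ (-(lam : ℂ))) := by
  have hd : DifferentiableOn ℂ (fun r : ℂ => (1 - 2 * r * x + r ^ 2) ^ (-(lam : ℂ))) (Metric.ball 0 1) := by
    intro w hw
    have := slit1 x hx w (by simpa using hw)
    apply DifferentiableAt.differentiableWithinAt
    exact DifferentiableAt.cpow (f := fun r : ℂ => 1 - 2 * r * x + r ^ 2) (by fun_prop) (by fun_prop) this
  have h := Complex.hasSum_taylorSeries_on_ball hd (z := r) (by simpa using hr)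
  refine HasSum.congr_fun h (fun l => ?_)
  rw [coef_of_hasSum _ 0 (fun l => (gegenbauer lam l x : ℂ))]
  · have f1 : (Nat.factorial l : ℂ) ≠ 0 := by exact_mod_cast Nat.factorial_ne_zero _
    simp only [smul_eq_mul, sub_zero]
    field_simp
  · filter_upwards [Metric.ball_mem_nhds (0 : ℂ) (show (0:ℝ) < 1 / 4 by norm_num)] with z hz
    simpa using geg_small lam hl x hx z (by simpa using hz)

theorem tlu_iter {ι : Type*} {φ : Filter ι} [φ.NeBot] {U : Set ℂ} (hU : IsOpen U) (k : ℕ) :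
    ∀ (F : ι → ℂ → ℂ) (f : ℂ → ℂ), TendstoLocallyUniformlyOn F f φ U →
      (∀ᶠ n in φ, DifferentiableOn ℂ (F n) U) →
      TendstoLocallyUniformlyOn (fun n => iteratedDeriv k (F n)) (iteratedDeriv k f) φ U := by
  induction k with
  | zero => intro F f h _; simpa using h
  | succ k ih =>
    intro F f h hd
    simp only [iteratedDeriv_succ']
    exact ih (fun n => deriv (F n)) (deriv f) (h.deriv hd hU)
      (hd.mono fun n hn => hn.deriv hU)

theorem series_deriv (lam : ℝ) (hl : 0 < lam) (x : ℝ) (hx : |x| ≤ 1) (a : ℝ) (ha : 0 < a) (A : ℂ) (k : ℕ) :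
    HasSum (fun l : ℕ => A * (gegenbauer lam l x : ℂ) * ((-(a * l)) ^ k * Complex.exp (-(a * l))))
      (iteratedDeriv k (fun z : ℂ => A * (1 - 2 * Complex.exp (-(a * z)) * x
        + Complex.exp (-(a * z)) ^ 2) ^ (-(lam : ℂ))) 1) := by
  set U : Set ℂ := {z | 1 / 2 < z.re} with hUdef
  have hU : IsOpen U := isOpen_lt continuous_const Complex.continuous_re
  set f : ℕ → ℂ → ℂ := fun l z => A * (gegenbauer lam l x : ℂ) * Complex.exp ((-(a * l)) * z) with hf
  have hexp : ∀ (z : ℂ), ‖Complex.exp (-(a * z))‖ = Real.exp (-(a * z.re)) := by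
    intro z; rw [Complex.norm_exp]; simp
  have hpow : ∀ (l : ℕ) (z : ℂ), Complex.exp ((-(a * l)) * z) = Complex.exp (-(a * z)) ^ l := by
    intro l z; rw [← Complex.exp_nat_mul]; congr 1; ring
  have hlt : ∀ z ∈ U, ‖Complex.exp (-(a * z))‖ < 1 := by
    intro z hz
    have hz' : 1 / 2 < z.re := hz
    rw [hexp, Real.exp_lt_one_iff]
    nlinarith
  have hsum : ∀ z ∈ U, ∑' l, f l z = A * (1 - 2 * Complex.exp (-(a * z)) * x
        + Complex.exp (-(a * z)) ^ 2) ^ (-(lam : ℂ)) := by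
    intro z hz
    have := (geg_gen lam hl x hx _ (hlt z hz)).mul_left A
    rw [← this.tsum_eq]
    congr 1; ext l
    simp only [hf, hpow]; ring
  have hu : Summable (fun l : ℕ => ‖A * ((gegenbauer lam l x : ℂ) * (Real.exp (-(a * (1/2))) : ℂ) ^ l)‖) := by
    refine ((geg_gen lam hl x hx _ ?_).mul_left A).summable.norm
    rw [Complex.norm_real, Real.norm_of_nonneg (Real.exp_pos _).le, Real.exp_lt_one_iff]
    nlinarith
  have hT := (tendstoUniformlyOn_tsum hu (f := f) (s := U) (fun l z hz => by
    have hz' : 1 / 2 < z.re := hz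
    simp only [hf, hpow, norm_mul, norm_pow, hexp]
    rw [Complex.norm_real (Real.exp _), Real.norm_of_nonneg (Real.exp_pos _).le, mul_assoc]
    gcongr)).congr_right hsum
  have hT2 := tlu_iter hU k _ _ hT.tendstoLocallyUniformlyOn (Eventually.of_forall fun s => by
    simp only [hf]; fun_prop)
  have h1 : (1 : ℂ) ∈ U := by simp [hUdef]; norm_num
  have := hT2.tendsto_at h1
  unfold HasSum
  simp only [SummationFilter.unconditional_filter]
  refine this.congr fun s => ?_
  rw [iteratedDeriv_fun_sum (fun i _ => by simp only [hf]; fun_prop)]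
  apply Finset.sum_congr rfl
  intro l _
  simp only [hf]
  rw [iteratedDeriv_const_mul_field, iteratedDeriv_cexp_const_mul]
  simp

theorem scal (lam : ℝ) (hl : 0 < lam) (c : ℝ) (hc : 0 < c) (u : ℂ) :
    ((c : ℂ) * u) ^ (-(lam : ℂ)) = ((c ^ (-lam) : ℝ) : ℂ) * u ^ (-(lam : ℂ)) := by
  have hl' : -(lam : ℂ) ≠ 0 := by
    rw [neg_ne_zero]; exact_mod_cast hl.ne'
  by_cases hu : u = 0
  · simp [hu, Complex.zero_cpow hl']
  have hc' : (c : ℂ) ≠ 0 := by exact_mod_cast hc.ne'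
  rw [Complex.ofReal_cpow hc.le, Complex.cpow_def_of_ne_zero (mul_ne_zero hc' hu),
    Complex.log_ofReal_mul hc hu, Complex.cpow_def_of_ne_zero hc', Complex.cpow_def_of_ne_zero hu,
    Complex.ofReal_log hc.le, ← Complex.exp_add]
  push_cast
  ring_nf

theorem lim_deriv (lam : ℝ) (hl : 0 < lam) (t : ℝ) (k : ℕ) :
    iteratedDeriv k (fun z : ℂ => (z ^ 2 + (t : ℂ) ^ 2) ^ (-(lam : ℂ))) 1 =
      Nat.factorial k * ((((1 + t ^ 2) ^ (-lam) : ℝ) : ℂ) * gegenbauer lam k (1 / Real.sqrt (1 + t ^ 2))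
        * (-1 / (Real.sqrt (1 + t ^ 2) : ℂ)) ^ k) := by
  have hpos : 0 < 1 + t ^ 2 := by positivity
  set ρ := Real.sqrt (1 + t ^ 2) with hρ
  have hρ2 : ρ ^ 2 = 1 + t ^ 2 := Real.sq_sqrt hpos.le
  have hρ1 : 1 ≤ ρ := by rw [hρ, Real.one_le_sqrt]; nlinarith
  have hρ0 : (ρ : ℂ) ≠ 0 := by exact_mod_cast (by linarith : ρ ≠ 0)
  have hρc : (ρ : ℂ) ^ 2 = 1 + (t : ℂ) ^ 2 := by exact_mod_cast hρ2
  apply coef_of_hasSum _ 1 (fun k => ((((1 + t ^ 2) ^ (-lam) : ℝ) : ℂ) * gegenbauer lam k (1 / ρ)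
        * (-1 / (ρ : ℂ)) ^ k))
  filter_upwards [Metric.ball_mem_nhds (1 : ℂ) one_pos] with z hz
  have hz' : ‖z - 1‖ < 1 := by simpa [dist_eq_norm] using hz
  have hx : |1 / ρ| ≤ 1 := by
    rw [abs_of_nonneg (by positivity)]
    exact (div_le_one (by linarith)).2 hρ1
  have h := (geg_gen lam hl (1 / ρ) hx (-1 / (ρ : ℂ) * (z - 1)) (by
    rw [norm_mul, norm_div, norm_neg, norm_one, Complex.norm_real, Real.norm_of_nonneg (by linarith)]
    have : 1 / ρ ≤ 1 := (div_le_one (by linarith)).2 hρ1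
    nlinarith [norm_nonneg (z - 1)])).mul_left (((1 + t ^ 2) ^ (-lam) : ℝ) : ℂ)
  rw [← scal lam hl _ hpos] at h
  have e : (z ^ 2 + (t : ℂ) ^ 2) = ((1 + t ^ 2 : ℝ) : ℂ) * (1 - 2 * (-1 / (ρ : ℂ) * (z - 1)) * ((1 / ρ : ℝ) : ℂ)
      + (-1 / (ρ : ℂ) * (z - 1)) ^ 2) := by
    push_cast
    rw [← hρc]
    field_simp
    rw [hρc]
    ring
  rw [e]
  refine HasSum.congr_fun h fun l => ?_
  rw [mul_pow]; ring

theorem cos_form (y : ℝ) : Real.cos (2 * Real.arctan y) = 1 - 2 * y ^ 2 / (1 + y ^ 2) := by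
  rw [Real.cos_two_mul, Real.cos_sq_arctan]
  have : 1 + y ^ 2 ≠ 0 := by positivity
  field_simp
  ring

theorem base_lim (t : ℝ) (z₀ : ℂ) :
    Tendsto (fun p : ℝ × ℂ => ((((p.1 ^ 2)⁻¹ : ℝ) : ℂ) * (1 - 2 * Complex.exp (-(p.1 * p.2))
      * (Real.cos (2 * Real.arctan (p.1 * t / 2)) : ℂ) + Complex.exp (-(p.1 * p.2)) ^ 2)))
      (nhdsWithin 0 (Set.Ioi 0) ×ˢ nhds z₀) (nhds (z₀ ^ 2 + (t : ℂ) ^ 2)) := by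
  set g : ℂ → ℂ := dslope (fun w => 1 - Complex.exp (-w)) 0 with hg
  have hd : HasDerivAt (fun w : ℂ => 1 - Complex.exp (-w)) 1 0 := by
    have := ((hasDerivAt_neg (0 : ℂ)).cexp).const_sub 1
    simpa using this
  have hg0 : g 0 = 1 := by rw [hg, dslope_same, hd.deriv]
  have hgc : ContinuousAt g 0 := continuousAt_dslope_same.2 hd.differentiableAt
  have hgm : ∀ w, w * g w = 1 - Complex.exp (-w) := by
    intro w
    have := sub_smul_dslope (fun w : ℂ => 1 - Complex.exp (-w)) 0 w
    simpa using this
  have hle : (nhdsWithin (0 : ℝ) (Set.Ioi 0) ×ˢ nhds z₀) ≤ nhds ((0 : ℝ), z₀) := by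
    rw [nhds_prod_eq]; exact Filter.prod_mono nhdsWithin_le_nhds le_rfl
  have hcont : ContinuousAt (fun p : ℝ × ℂ => (p.2 * g (p.1 * p.2)) ^ 2 +
      Complex.exp (-(p.1 * p.2)) * ((t ^ 2 / (1 + (p.1 * t / 2) ^ 2) : ℝ) : ℂ)) ((0 : ℝ), z₀) := by
    have h1 : ContinuousAt (fun p : ℝ × ℂ => g (p.1 * p.2)) ((0 : ℝ), z₀) := by
      apply ContinuousAt.comp (g := g)
      · simpa using hgc
      · fun_prop
    have h2 : ContinuousAt (fun p : ℝ × ℂ => t ^ 2 / (1 + (p.1 * t / 2) ^ 2)) ((0 : ℝ), z₀) := by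
      apply ContinuousAt.div <;> first | fun_prop | simp
    have h3 : ContinuousAt (fun p : ℝ × ℂ => ((t ^ 2 / (1 + (p.1 * t / 2) ^ 2) : ℝ) : ℂ)) ((0 : ℝ), z₀) :=
      Complex.continuous_ofReal.continuousAt.comp h2
    have h4 : ContinuousAt (fun p : ℝ × ℂ => Complex.exp (-(p.1 * p.2))) ((0 : ℝ), z₀) := by fun_prop
    exact ((continuousAt_snd.mul h1).pow 2).add (h4.mul h3)
  have hT := hcont.tendsto.mono_left hle
  simp only [Complex.ofReal_zero, zero_mul, hg0, mul_one, neg_zero, Complex.exp_zero, one_mul, zero_div,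
    ne_eq, OfNat.ofNat_ne_zero, not_false_eq_true, zero_pow, add_zero, div_one, Complex.ofReal_pow] at hT
  refine hT.congr' ?_
  have hev : ∀ᶠ p : ℝ × ℂ in nhdsWithin (0 : ℝ) (Set.Ioi 0) ×ˢ nhds z₀, 0 < p.1 :=
    (eventually_mem_nhdsWithin (a := (0 : ℝ)) (s := Set.Ioi 0)).prod_inl _
  filter_upwards [hev] with p hp
  have hp0 : (p.1 : ℂ) ≠ 0 := by exact_mod_cast hp.ne'
  have e1 : p.2 * g (p.1 * p.2) = (1 - Complex.exp (-(p.1 * p.2))) / p.1 := by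
    rw [← hgm]; field_simp
  rw [e1, cos_form]
  have h5 : (1 + (p.1 * t / 2) ^ 2 : ℂ) ≠ 0 := by
    have : (1 + (p.1 * t / 2) ^ 2 : ℝ) ≠ 0 := by positivity
    exact_mod_cast this
  push_cast
  field_simp
  ring

theorem slit2 (t : ℝ) (z : ℂ) (hz : 0 < z.re) : z ^ 2 + (t : ℂ) ^ 2 ∈ Complex.slitPlane := by
  rw [Complex.mem_slitPlane_iff]
  by_contra! hcon
  obtain ⟨h1, h2⟩ := hcon
  simp [pow_two] at h1 h2
  have h3 : z.re * z.im = 0 := by linarith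
  rcases mul_eq_zero.mp h3 with h | h
  · linarith
  · rw [h] at h1
    nlinarith [sq_nonneg t]

/-- The rescaled generating function. -/
noncomputable def scaledGen (lam t a : ℝ) (z : ℂ) : ℂ :=
  ((((a ^ 2)⁻¹ : ℝ) : ℂ) * (1 - 2 * Complex.exp (-(a * z))
      * (Real.cos (2 * Real.arctan (a * t / 2)) : ℂ) + Complex.exp (-(a * z)) ^ 2)) ^ (-(lam : ℂ))

theorem scaledGen_lim (lam : ℝ) (hl : 0 < lam) (t : ℝ) (k : ℕ) :
    Tendsto (fun a : ℝ => iteratedDeriv k (scaledGen lam t a) 1) (nhdsWithin 0 (Set.Ioi 0))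
      (nhds (iteratedDeriv k (fun z : ℂ => (z ^ 2 + (t : ℂ) ^ 2) ^ (-(lam : ℂ))) 1)) := by
  set U : Set ℂ := {z | 0 < z.re} with hUdef
  have hU : IsOpen U := isOpen_lt continuous_const Complex.continuous_re
  have h1 : (1 : ℂ) ∈ U := by simp [hUdef]
  refine (tlu_iter hU k (fun a => scaledGen lam t a) _ ?_ ?_).tendsto_at h1
  · rw [hU.tendstoLocallyUniformlyOn_iff_forall_tendsto]
    intro z₀ hz₀
    have hs := slit2 t z₀ hz₀
    have hc : ContinuousAt (fun w : ℂ => w ^ (-(lam : ℂ))) (z₀ ^ 2 + (t : ℂ) ^ 2) :=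
      continuousAt_cpow_const hs
    have hF := hc.tendsto.comp (base_lim t z₀)
    have hf : Tendsto (fun p : ℝ × ℂ => (p.2 ^ 2 + (t : ℂ) ^ 2) ^ (-(lam : ℂ)))
        (nhdsWithin (0 : ℝ) (Set.Ioi 0) ×ˢ nhds z₀) (nhds ((z₀ ^ 2 + (t : ℂ) ^ 2) ^ (-(lam : ℂ)))) := by
      refine hc.tendsto.comp (Tendsto.comp (g := fun z : ℂ => z ^ 2 + (t : ℂ) ^ 2) ?_ tendsto_snd)
      exact Continuous.tendsto (by fun_prop) z₀
    have := (hf.prodMk_nhds hF).mono_right (nhds_le_uniformity _)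
    exact this
  · filter_upwards [self_mem_nhdsWithin] with a ha z hz
    have ha' : 0 < a := ha
    have hz' : 0 < z.re := hz
    apply DifferentiableAt.differentiableWithinAt
    have e : scaledGen lam t a = fun z => _ :=
      funext fun z => scal lam hl _ (by positivity : 0 < (a ^ 2)⁻¹) _
    rw [e]
    apply DifferentiableAt.const_mul
    refine DifferentiableAt.cpow (f := fun z : ℂ => 1 - 2 * Complex.exp (-(a * z))
      * (Real.cos (2 * Real.arctan (a * t / 2)) : ℂ) + Complex.exp (-(a * z)) ^ 2)
      (by fun_prop) (by fun_prop) ?_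
    refine slit1 _ (Real.abs_cos_le_one _) _ ?_
    rw [Complex.norm_exp, Real.exp_lt_one_iff]
    simp
    positivity

theorem key (lam : ℝ) (hl : 0 < lam) (t a : ℝ) (ha : 0 < a) (k : ℕ) :
    HasSum (fun l : ℕ => ((a ^ 2)⁻¹) ^ (-lam) * gegenbauer lam l (Real.cos (2 * Real.arctan (a * t / 2)))
      * ((a * l) ^ k * Real.exp (-(a * l))))
      ((-1) ^ k * (iteratedDeriv k (scaledGen lam t a) 1).re) := by
  have e : scaledGen lam t a = fun z => _ :=
      funext fun z => scal lam hl _ (by positivity : 0 < (a ^ 2)⁻¹) _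
  have h := series_deriv lam hl _ (Real.abs_cos_le_one (2 * Real.arctan (a * t / 2))) a ha
    ((((a ^ 2)⁻¹) ^ (-lam) : ℝ) : ℂ) k
  rw [← e] at h
  have h2 := (Complex.hasSum_re h).mul_left ((-1 : ℝ) ^ k)
  have e2 : ∀ l : ℕ, ((a ^ 2)⁻¹) ^ (-lam) * gegenbauer lam l (Real.cos (2 * Real.arctan (a * t / 2)))
      * ((a * l) ^ k * Real.exp (-(a * l))) = (-1 : ℝ) ^ k *
      ((((((a ^ 2)⁻¹) ^ (-lam) : ℝ) : ℂ) * (gegenbauer lam l (Real.cos (2 * Real.arctan (a * t / 2))) : ℂ)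
        * ((-(a * l)) ^ k * Complex.exp (-(a * l)))).re) := by
    intro l
    have e3 : ((((((a ^ 2)⁻¹) ^ (-lam) : ℝ) : ℂ) * (gegenbauer lam l (Real.cos (2 * Real.arctan (a * t / 2))) : ℂ)
        * ((-(a * l)) ^ k * Complex.exp (-(a * l)))))
      = ((((a ^ 2)⁻¹) ^ (-lam) * gegenbauer lam l (Real.cos (2 * Real.arctan (a * t / 2)))
      * ((-(a * l)) ^ k * Real.exp (-(a * l))) : ℝ) : ℂ) := by
      push_cast; rfl
    rw [e3, Complex.ofReal_re, neg_pow (a * (l : ℝ)) k]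
    have : (-1 : ℝ) ^ k * (-1) ^ k = 1 := by rw [← mul_pow]; simp
    linear_combination (-(((a ^ 2)⁻¹) ^ (-lam) * gegenbauer lam l (Real.cos (2 * Real.arctan (a * t / 2)))
      * ((a * l) ^ k * Real.exp (-(a * l))))) * this
  exact HasSum.congr_fun h2 e2

theorem key_lim (lam : ℝ) (hl : 0 < lam) (t : ℝ) (k : ℕ) :
    Tendsto (fun a : ℝ => (-1) ^ k * (iteratedDeriv k (scaledGen lam t a) 1).re)
      (nhdsWithin 0 (Set.Ioi 0))
      (nhds (Nat.factorial k * ((1 + t ^ 2) ^ (-lam) * gegenbauer lam k (1 / Real.sqrt (1 + t ^ 2))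
        * (1 / (Real.sqrt (1 + t ^ 2))) ^ k))) := by
  have h := scaledGen_lim lam hl t k
  rw [lim_deriv lam hl] at h
  have h2 := ((Complex.continuous_re.tendsto _).comp h).const_mul ((-1 : ℝ) ^ k)
  convert! h2 using 2
  have e3 : (Nat.factorial k * ((((1 + t ^ 2) ^ (-lam) : ℝ) : ℂ) * gegenbauer lam k (1 / Real.sqrt (1 + t ^ 2))
        * (-1 / (Real.sqrt (1 + t ^ 2) : ℂ)) ^ k) : ℂ) =
      ((Nat.factorial k * ((1 + t ^ 2) ^ (-lam) * gegenbauer lam k (1 / Real.sqrt (1 + t ^ 2))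
        * (-1 / (Real.sqrt (1 + t ^ 2))) ^ k) : ℝ) : ℂ) := by push_cast; rfl
  rw [e3, Complex.ofReal_re, div_pow (-1 : ℝ), div_pow (1 : ℝ), one_pow]
  have : (-1 : ℝ) ^ k * (-1) ^ k = 1 := by rw [← mul_pow]; simp
  linear_combination (-(Nat.factorial k * ((1 + t ^ 2) ^ (-lam) * gegenbauer lam k (1 / Real.sqrt (1 + t ^ 2))
        * (1 / (Real.sqrt (1 + t ^ 2)) ^ k)))) * this

/-- the Euclidean limit of the Poisson wavelets:
`lim_{a→0⁺} a^n g_a^m(cos(2 arctan(at/2)))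
  = (1/(Σ_n λ)) (m+1)! C_{m+1}^λ(1/√(1+t²)) / (1+t²)^{(m+n)/2}`. -/
theorem stmt12 (n m : ℕ) (hn : 2 ≤ n) (hm : 1 ≤ m) (t : ℝ) (ht : 0 ≤ t) :
    Tendsto (fun a : ℝ => a ^ n * pw n a m (Real.cos (2 * Real.arctan (a * t / 2))))
      (nhdsWithin 0 (Set.Ioi 0))
      (nhds ((1 / (sigmaN n * lamb n)) * (Nat.factorial (m + 1) : ℝ) *
        gegenbauer (lamb n) (m + 1) (1 / Real.sqrt (1 + t ^ 2)) /
        (1 + t ^ 2) ^ (((m : ℝ) + n) / 2))) := by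
  have hl : 0 < lamb n := by
    unfold lamb
    have : (2 : ℝ) ≤ n := by exact_mod_cast hn
    linarith
  set lam := lamb n with hlam
  have hL1 := key_lim lam hl t (m + 1)
  have hL0 := key_lim lam hl t m
  have hid : Tendsto (fun a : ℝ => a * lam) (nhdsWithin 0 (Set.Ioi 0)) (nhds 0) := by
    have : Tendsto (fun a : ℝ => a * lam) (nhds 0) (nhds (0 * lam)) :=
      Continuous.tendsto (by fun_prop) 0
    rw [zero_mul] at this
    exact this.mono_left nhdsWithin_le_nhds
  have hT := (hL1.add (hid.mul hL0)).const_mul (1 / (sigmaN n * lam))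
  rw [zero_mul, add_zero] at hT
  have hpos : 0 < 1 + t ^ 2 := by positivity
  have hval : (1 / (sigmaN n * lam)) * (Nat.factorial (m + 1) : ℝ) *
        gegenbauer lam (m + 1) (1 / Real.sqrt (1 + t ^ 2)) /
        (1 + t ^ 2) ^ (((m : ℝ) + n) / 2) = 1 / (sigmaN n * lam) *
      (Nat.factorial (m + 1) * ((1 + t ^ 2) ^ (-lam) * gegenbauer lam (m + 1) (1 / Real.sqrt (1 + t ^ 2))
        * (1 / (Real.sqrt (1 + t ^ 2))) ^ (m + 1))) := by
    have e : (1 + t ^ 2) ^ (-lam) * (1 / (Real.sqrt (1 + t ^ 2))) ^ (m + 1)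
        = ((1 + t ^ 2) ^ (((m : ℝ) + n) / 2))⁻¹ := by
      rw [one_div, Real.sqrt_eq_rpow, ← Real.rpow_neg hpos.le,
        ← Real.rpow_natCast _ (m + 1), ← Real.rpow_mul hpos.le,
        ← Real.rpow_add hpos, ← Real.rpow_neg hpos.le]
      congr 1
      rw [hlam]; unfold lamb
      push_cast; ring
    rw [div_eq_mul_inv, ← e]; ring
  rw [hval]
  refine hT.congr' ?_
  filter_upwards [self_mem_nhdsWithin] with a ha
  have ha' : 0 < a := ha
  have k1 := key lam hl t a ha' (m + 1)
  have k0 := (key lam hl t a ha' m).mul_left (a * lam)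
  rw [← (k1.add k0).tsum_eq]
  unfold pw
  rw [← hlam]
  have hA : ((a ^ 2)⁻¹) ^ (-lam) * a = a ^ n := by
    rw [Real.inv_rpow (by positivity), ← Real.rpow_neg (by positivity), neg_neg, ← Real.rpow_natCast a 2,
      ← Real.rpow_mul ha'.le, ← Real.rpow_add_one ha'.ne', ← Real.rpow_natCast a n]
    congr 1
    rw [hlam]; unfold lamb
    push_cast; ring
  rw [← tsum_mul_left, ← tsum_mul_left, ← tsum_mul_left, ← hA]
  congr 1; ext l
  field_simp
  ring
end
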